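/- Fix p ≥ 2n−1 and set Λ_p = sup{λ_{1,p}(γ) : γ ∈ R_h}. Then there exists a curve α ∈ R_h such that λ_{1,p}(α) = Λ_p and α(t) ∈ {(x,y) ∈ P : x² + y² ≤ x₀² + y₀²} for all t ∈ [0,1). -/

import Mathlib

open Set MeasureTheory Filter Topology

noncomputable section

/-- The closed quarter plane `P`. -/
def Pset : Set (ℝ × ℝ) := {z | 0 ≤ z.1 ∧ 0 ≤ z.2}

/-- The interior `P°` of the quarter plane. -/
def Pint : Set (ℝ × ℝ) := {z | 0 < z.1 ∧ 0 < z.2}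

/-- The boundary `∂P` of the quarter plane. -/
def Pbdry : Set (ℝ × ℝ) := {z | (0 ≤ z.1 ∧ 0 ≤ z.2) ∧ (z.1 = 0 ∨ z.2 = 0)}

/-- `F(x,y) = c_n x^(n-1) y^(n-1)`. -/
def Fvol (n : ℕ) (cn : ℝ) (z : ℝ × ℝ) : ℝ := cn * z.1 ^ (n - 1) * z.2 ^ (n - 1)

/-- Euclidean speed of a curve at `t`, computed with derivatives within `s`. -/
def gSpeedOn (s : Set ℝ) (α : ℝ → ℝ × ℝ) (t : ℝ) : ℝ :=
  Real.sqrt ((derivWithin (fun u => (α u).1) s t) ^ 2 + (derivWithin (fun u => (α u).2) s t) ^ 2)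

/-- Euclidean speed of a curve defined on `[0,1]`. -/
def gSpeed (α : ℝ → ℝ × ℝ) : ℝ → ℝ := gSpeedOn (Icc 0 1) α

/-- Euclidean length `L_g` of a curve on `[0,1]`. -/
def Lg (α : ℝ → ℝ × ℝ) : ℝ := ∫ t in (0:ℝ)..1, gSpeed α t

/-- The `h`-speed `|γ'|_h = F(γ) |γ'|_g`, with derivatives within `s`. -/
def hSpeedOn (n : ℕ) (cn : ℝ) (s : Set ℝ) (α : ℝ → ℝ × ℝ) (t : ℝ) : ℝ :=
  Fvol n cn (α t) * gSpeedOn s α t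

/-- The `h`-speed for curves defined on `[0,1)`. -/
def hSpeed (n : ℕ) (cn : ℝ) (α : ℝ → ℝ × ℝ) : ℝ → ℝ := hSpeedOn n cn (Ico 0 1) α

/-- The `h`-length `L_h` of a curve on `[0,1)`. -/
def Lh (n : ℕ) (cn : ℝ) (α : ℝ → ℝ × ℝ) : ℝ := ∫ t in (0:ℝ)..1, hSpeed n cn α t

/-- Numerator integrand of the `g`-Rayleigh quotient:
`|w'(t)|^p F(α t) |α'(t)|_g^(1-p)`. -/
def numG (n : ℕ) (cn p : ℝ) (s : Set ℝ) (α : ℝ → ℝ × ℝ) (w : ℝ → ℝ) (t : ℝ) : ℝ :=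
  |derivWithin w (Icc 0 1) t| ^ p * Fvol n cn (α t) * gSpeedOn s α t ^ (1 - p)

/-- Denominator integrand of the `g`-Rayleigh quotient:
`|w(t)|^p F(α t) |α'(t)|_g`. -/
def denG (n : ℕ) (cn p : ℝ) (s : Set ℝ) (α : ℝ → ℝ × ℝ) (w : ℝ → ℝ) (t : ℝ) : ℝ :=
  |w t| ^ p * Fvol n cn (α t) * gSpeedOn s α t

/-- First Dirichlet eigenvalue of the `p`-Laplacian along a curve, `g`-form:
infimum of the Rayleigh quotient over Lipschitz test functions on `[0,1]`
vanishing at `0` (with admissible, i.e. integrable with positive denominator,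
Rayleigh quotients). -/
def lambdaGOn (n : ℕ) (cn p : ℝ) (s : Set ℝ) (α : ℝ → ℝ × ℝ) : ℝ :=
  sInf {q | ∃ w : ℝ → ℝ, (∃ K, LipschitzOnWith K w (Icc 0 1)) ∧ w 0 = 0 ∧
    IntervalIntegrable (numG n cn p s α w) volume 0 1 ∧
    IntervalIntegrable (denG n cn p s α w) volume 0 1 ∧
    (0 < ∫ t in (0:ℝ)..1, denG n cn p s α w t) ∧
    q = (∫ t in (0:ℝ)..1, numG n cn p s α w t) / (∫ t in (0:ℝ)..1, denG n cn p s α w t)}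

/-- `λ_{1,p}` in the `g`-form for curves on `[0,1]`. -/
def lambdaG (n : ℕ) (cn p : ℝ) (α : ℝ → ℝ × ℝ) : ℝ := lambdaGOn n cn p (Icc 0 1) α

/-- Numerator integrand of the `h`-Rayleigh quotient on `[c,d]`:
`|w'(t)|^p F(γ t)^p |γ'(t)|_h^(1-p)`. -/
def numH (n : ℕ) (cn p c d : ℝ) (s : Set ℝ) (γ : ℝ → ℝ × ℝ) (w : ℝ → ℝ) (t : ℝ) : ℝ :=
  |derivWithin w (Icc c d) t| ^ p * Fvol n cn (γ t) ^ p * hSpeedOn n cn s γ t ^ (1 - p)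

/-- Denominator integrand of the `h`-Rayleigh quotient: `|w(t)|^p |γ'(t)|_h`. -/
def denH (n : ℕ) (cn p : ℝ) (s : Set ℝ) (γ : ℝ → ℝ × ℝ) (w : ℝ → ℝ) (t : ℝ) : ℝ :=
  |w t| ^ p * hSpeedOn n cn s γ t

/-- `λ_{1,p}` in the `h`-form for a curve on `[c,d)`, with test functions
Lipschitz on `[c,d]` vanishing at `c`. -/
def lambdaHOn (n : ℕ) (cn p c d : ℝ) (s : Set ℝ) (γ : ℝ → ℝ × ℝ) : ℝ :=
  sInf {q | ∃ w : ℝ → ℝ, (∃ K, LipschitzOnWith K w (Icc c d)) ∧ w c = 0 ∧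
    IntervalIntegrable (numH n cn p c d s γ w) volume c d ∧
    IntervalIntegrable (denH n cn p s γ w) volume c d ∧
    (0 < ∫ t in c..d, denH n cn p s γ w t) ∧
    q = (∫ t in c..d, numH n cn p c d s γ w t) / (∫ t in c..d, denH n cn p s γ w t)}

/-- `λ_{1,p}` in the `h`-form for curves on `[0,1)`. -/
def lambdaH (n : ℕ) (cn p : ℝ) (γ : ℝ → ℝ × ℝ) : ℝ :=
  lambdaHOn n cn p 0 1 (Ico 0 1) γ

/-- The class `𝒞` of `C¹` curves from `(x₀,y₀)` to the boundary, with constant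
speed, interior image on `[0,1)`, endpoint away from the origin, and meeting the
boundary orthogonally. -/
def MemC (x0 y0 : ℝ) (α : ℝ → ℝ × ℝ) : Prop :=
  ContDiffOn ℝ 1 α (Icc 0 1) ∧
  α 0 = (x0, y0) ∧
  (∀ t ∈ Ico (0:ℝ) 1, α t ∈ Pint) ∧
  α 1 ∈ Pbdry ∧ α 1 ≠ ((0 : ℝ), (0 : ℝ)) ∧
  (∀ t ∈ Icc (0:ℝ) 1, gSpeed α t = Lg α) ∧
  ((α 1).1 = 0 → derivWithin (fun u => (α u).2) (Icc 0 1) 1 = 0) ∧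
  ((α 1).2 = 0 → derivWithin (fun u => (α u).1) (Icc 0 1) 1 = 0)

/-- The Simons cone curve `σ(t) = (1-t)·(R,R)`. -/
def simonsCurve (R : ℝ) : ℝ → ℝ × ℝ := fun t => ((1 - t) * R, (1 - t) * R)

/-- The class `R_h`: locally Lipschitz curves on `[0,1)` with image in `P°`,
starting at `(x₀,y₀)`, with essentially bounded `h`-speed, reaching the collapsed
boundary point as `t → 1` (i.e. `x(γ t)·y(γ t) → 0`). -/
def MemRh (n : ℕ) (cn x0 y0 : ℝ) (γ : ℝ → ℝ × ℝ) : Prop :=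
  γ 0 = (x0, y0) ∧
  (∀ t ∈ Ico (0:ℝ) 1, γ t ∈ Pint) ∧
  (∀ a ∈ Ico (0:ℝ) 1, ∃ K, LipschitzOnWith K γ (Icc 0 a)) ∧
  (∃ M : ℝ, ∀ᵐ t ∂(volume : Measure ℝ), t ∈ Ico (0:ℝ) 1 → hSpeed n cn γ t ≤ M) ∧
  Tendsto (fun t => (γ t).1 * (γ t).2) (𝓝[<] (1:ℝ)) (𝓝 0)

/-- The class `R_h^+`: continuous curves on `[0,1]` into `P` ending on `∂P`
whose restriction to `[0,1)` belongs to `R_h`. -/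
def MemRhPlus (n : ℕ) (cn x0 y0 : ℝ) (α : ℝ → ℝ × ℝ) : Prop :=
  ContinuousOn α (Icc 0 1) ∧ (∀ t ∈ Icc (0:ℝ) 1, α t ∈ Pset) ∧ α 1 ∈ Pbdry ∧
  MemRh n cn x0 y0 α

/-- The class `R_g`: Lipschitz curves on `[0,1]` from `(x₀,y₀)` to `∂P` with
interior image on `[0,1)`. -/
def MemRg (x0 y0 : ℝ) (α : ℝ → ℝ × ℝ) : Prop :=
  (∃ K, LipschitzOnWith K α (Icc 0 1)) ∧ α 0 = (x0, y0) ∧ α 1 ∈ Pbdry ∧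
  ∀ t ∈ Ico (0:ℝ) 1, α t ∈ Pint

/-- The coordinate `u(x,y) = (x² - y²)/2`. -/
def ucoord (z : ℝ × ℝ) : ℝ := (z.1 ^ 2 - z.2 ^ 2) / 2

/-- The coordinate `v(x,y) = xy`. -/
def vcoord (z : ℝ × ℝ) : ℝ := z.1 * z.2

/-- The coordinate `r = √(u² + v²)`. -/
def rcoord (z : ℝ × ℝ) : ℝ := Real.sqrt (ucoord z ^ 2 + vcoord z ^ 2)

/-- The class `R_g^*`: simple curves in `R_g` with a.e. constant speed,
`u(α(1)) > 0`, and `v(α(t)) ≥ c(1-t)` for some `c > 0`. -/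
def MemRgStar (x0 y0 : ℝ) (α : ℝ → ℝ × ℝ) : Prop :=
  MemRg x0 y0 α ∧ InjOn α (Icc 0 1) ∧
  (∀ᵐ t ∂(volume : Measure ℝ), t ∈ Icc (0:ℝ) 1 → gSpeed α t = Lg α) ∧
  0 < ucoord (α 1) ∧
  ∃ c > (0:ℝ), ∀ t ∈ Icc (0:ℝ) 1, c * (1 - t) ≤ vcoord (α t)

/-- Euclidean speed of a curve at `t`, computed with two-sided derivatives. -/
def spd (γ : ℝ → ℝ × ℝ) (t : ℝ) : ℝ :=
  Real.sqrt (deriv (fun u => (γ u).1) t ^ 2 + deriv (fun u => (γ u).2) t ^ 2)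

/-- The `h`-speed of a curve at `t`, computed with two-sided derivatives. -/
def hspd (n : ℕ) (cn : ℝ) (γ : ℝ → ℝ × ℝ) (t : ℝ) : ℝ := Fvol n cn (γ t) * spd γ t

/-- A locally Lipschitz curve `[0,T) → P°`. -/
structure IsCurve (T : ℝ) (γ : ℝ → ℝ × ℝ) : Prop where
  pos : ∀ t ∈ Ico (0:ℝ) T, γ t ∈ Pint
  lip : ∀ a ∈ Ico (0:ℝ) T, ∃ K, LipschitzOnWith K γ (Icc 0 a)

theorem abs_sub_le_integral_of_abs_deriv_le {f g : ℝ → ℝ} {a b : ℝ} (hab : a ≤ b)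
    {K : NNReal} (hf : LipschitzOnWith K f (Icc a b))
    (hfg : ∀ᵐ t, t ∈ Ioo a b → |deriv f t| ≤ g t) (hg : IntervalIntegrable g volume a b) :
    |f b - f a| ≤ ∫ t in a..b, g t := by
  have hac : AbsolutelyContinuousOnInterval f a b := by
    apply LipschitzOnWith.absolutelyContinuousOnInterval (K := K)
    rwa [uIcc_of_le hab]
  rw [← hac.integral_deriv_eq_sub]
  refine (intervalIntegral.abs_integral_le_integral_abs hab).trans ?_
  apply intervalIntegral.integral_mono_ae_restrict hab hac.intervalIntegrable_deriv.abs hg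
  rw [← restrict_Ioo_eq_restrict_Icc]
  exact (ae_restrict_iff' measurableSet_Ioo).2 hfg

theorem spd_nonneg (γ : ℝ → ℝ × ℝ) (t : ℝ) : 0 ≤ spd γ t := Real.sqrt_nonneg _

theorem abs_deriv_fst_le_spd (γ : ℝ → ℝ × ℝ) (t : ℝ) :
    |deriv (fun u => (γ u).1) t| ≤ spd γ t :=
  Real.abs_le_sqrt (by nlinarith [sq_nonneg (deriv (fun u => (γ u).2) t)])

theorem abs_deriv_snd_le_spd (γ : ℝ → ℝ × ℝ) (t : ℝ) :
    |deriv (fun u => (γ u).2) t| ≤ spd γ t :=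
  Real.abs_le_sqrt (by nlinarith [sq_nonneg (deriv (fun u => (γ u).1) t)])

theorem Fvol_pos {n : ℕ} {cn : ℝ} (hcn : 0 < cn) {z : ℝ × ℝ} (hz : z ∈ Pint) :
    0 < Fvol n cn z := by
  obtain ⟨h1, h2⟩ := hz
  unfold Fvol
  positivity

theorem continuous_Fvol (n : ℕ) (cn : ℝ) : Continuous (Fvol n cn) := by
  unfold Fvol
  fun_prop

theorem hspd_nonneg {n : ℕ} {cn : ℝ} (hcn : 0 < cn) {γ : ℝ → ℝ × ℝ} {t : ℝ} (h : γ t ∈ Pint) :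
    0 ≤ hspd n cn γ t :=
  mul_nonneg (Fvol_pos hcn h).le (spd_nonneg _ _)

theorem hSpeedOn_Ico_eq (n : ℕ) (cn : ℝ) (γ : ℝ → ℝ × ℝ) {t : ℝ} (ht : t ∈ Ioo (0:ℝ) 1) :
    hSpeedOn n cn (Ico 0 1) γ t = hspd n cn γ t := by
  have : Ico (0:ℝ) 1 ∈ 𝓝 t := Ico_mem_nhds ht.1 ht.2
  unfold hSpeedOn hspd gSpeedOn spd
  rw [derivWithin_of_mem_nhds this, derivWithin_of_mem_nhds this]

namespace IsCurve

variable {T : ℝ} {γ : ℝ → ℝ × ℝ}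

theorem lip_fst (h : IsCurve T γ) {a : ℝ} (ha : a ∈ Ico 0 T) :
    ∃ K, LipschitzOnWith K (fun u => (γ u).1) (Icc 0 a) := by
  obtain ⟨K, hK⟩ := h.lip a ha
  exact ⟨_, LipschitzWith.prod_fst.comp_lipschitzOnWith hK⟩

theorem lip_snd (h : IsCurve T γ) {a : ℝ} (ha : a ∈ Ico 0 T) :
    ∃ K, LipschitzOnWith K (fun u => (γ u).2) (Icc 0 a) := by
  obtain ⟨K, hK⟩ := h.lip a ha
  exact ⟨_, LipschitzWith.prod_snd.comp_lipschitzOnWith hK⟩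

theorem continuousOn (h : IsCurve T γ) : ContinuousOn γ (Ico 0 T) := by
  intro t ht
  have hm : (t + T) / 2 ∈ Ico 0 T := ⟨by linarith [ht.1, ht.2], by linarith [ht.2]⟩
  obtain ⟨K, hK⟩ := h.lip _ hm
  have hc := hK.continuousOn t ⟨ht.1, by linarith [ht.2]⟩
  refine hc.mono_of_mem_nhdsWithin ?_
  have h1 : Iio ((t + T) / 2) ∈ 𝓝 t := Iio_mem_nhds (by linarith [ht.2])
  filter_upwards [self_mem_nhdsWithin, nhdsWithin_le_nhds h1] with s hs hs'
  exact ⟨hs.1, le_of_lt hs'⟩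

end IsCurve

theorem ae_differentiableAt_of_lip {f : ℝ → ℝ} {T : ℝ}
    (h : ∀ a ∈ Ico 0 T, ∃ K, LipschitzOnWith K f (Icc 0 a)) :
    ∀ᵐ t, t ∈ Ioo 0 T → DifferentiableAt ℝ f t := by
  have hbv : LocallyBoundedVariationOn f (Ico 0 T) := by
    intro a b ha hb
    obtain ⟨K, hK⟩ := h b hb
    have := hK.locallyBoundedVariationOn 0 b ⟨le_rfl, hb.1⟩ ⟨hb.1, le_rfl⟩
    refine BoundedVariationOn.mono this ?_
    rintro s ⟨hs1, hs2⟩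
    exact ⟨⟨hs1.1, hs2.2⟩, ⟨hs1.1, hs2.2⟩⟩
  filter_upwards [hbv.ae_differentiableWithinAt_of_mem] with t ht hT
  exact (ht ⟨hT.1.le, hT.2⟩).differentiableAt (Ico_mem_nhds hT.1 hT.2)

namespace IsCurve

variable {T : ℝ} {γ : ℝ → ℝ × ℝ}

theorem ae_differentiableAt (h : IsCurve T γ) :
    ∀ᵐ t, t ∈ Ioo 0 T → DifferentiableAt ℝ (fun u => (γ u).1) t ∧
      DifferentiableAt ℝ (fun u => (γ u).2) t := by
  filter_upwards [ae_differentiableAt_of_lip (fun a ha => h.lip_fst ha),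
    ae_differentiableAt_of_lip (fun a ha => h.lip_snd ha)] with t h1 h2 ht
  exact ⟨h1 ht, h2 ht⟩

theorem aestronglyMeasurable_comp (h : IsCurve T γ) {f : ℝ × ℝ → ℝ} (hf : Continuous f) :
    AEStronglyMeasurable (fun t => f (γ t)) (volume.restrict (Ioo 0 T)) :=
  ((hf.comp_continuousOn h.continuousOn).mono Ioo_subset_Ico_self).aestronglyMeasurable
    measurableSet_Ioo

theorem measurable_spd (γ : ℝ → ℝ × ℝ) : Measurable (spd γ) :=
  (((measurable_deriv _).pow_const 2).add ((measurable_deriv _).pow_const 2)).sqrt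

theorem aestronglyMeasurable_hspd (h : IsCurve T γ) (n : ℕ) (cn : ℝ) :
    AEStronglyMeasurable (hspd n cn γ) (volume.restrict (Ioo 0 T)) :=
  (h.aestronglyMeasurable_comp (continuous_Fvol n cn)).mul
    (measurable_spd γ).aestronglyMeasurable

/-- A `C¹` function of the position whose differential is bounded by `C` times `F` in the
disc of radius `R` is Lipschitz along a curve of bounded `h`-speed. -/
theorem abs_sub_le {n : ℕ} {cn R M C : ℝ} (hC : 0 ≤ C) (h : IsCurve T γ)
    (hR : ∀ t ∈ Ico 0 T, (γ t).1 ^ 2 + (γ t).2 ^ 2 ≤ R ^ 2)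
    (hM : ∀ᵐ t, t ∈ Ioo 0 T → hspd n cn γ t ≤ M)
    {φ : ℝ × ℝ → ℝ} {A B : ℝ × ℝ → ℝ} (hφ : ContDiff ℝ 1 φ)
    (hd : ∀ z, HasFDerivAt φ (A z • ContinuousLinearMap.fst ℝ ℝ ℝ +
      B z • ContinuousLinearMap.snd ℝ ℝ ℝ) z)
    (hAB : ∀ z ∈ Pint, z.1 ^ 2 + z.2 ^ 2 ≤ R ^ 2 → |A z| + |B z| ≤ C * Fvol n cn z)
    {a b : ℝ} (ha : 0 ≤ a) (hab : a ≤ b) (hb : b < T) :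
    |φ (γ b) - φ (γ a)| ≤ C * M * (b - a) := by
  obtain ⟨K, hK⟩ := h.lip b ⟨ha.trans hab, hb⟩
  have hK' : LipschitzOnWith K γ (Icc a b) := hK.mono (Icc_subset_Icc_left ha)
  have hcomp : IsCompact (γ '' Icc a b) := isCompact_Icc.image_of_continuousOn hK'.continuousOn
  obtain ⟨K', hK''⟩ :=
    hφ.locallyLipschitz.locallyLipschitzOn.exists_lipschitzOnWith_of_compact hcomp
  have hlip : LipschitzOnWith (K' * K) (fun t => φ (γ t)) (Icc a b) :=
    hK''.comp hK' (mapsTo_image _ _)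
  have hae : ∀ᵐ t, t ∈ Ioo a b → |deriv (fun t => φ (γ t)) t| ≤ C * M := by
    filter_upwards [h.ae_differentiableAt, hM] with t h1 h2 ht
    have htT : t ∈ Ioo 0 T := ⟨ha.trans_lt ht.1, ht.2.trans hb⟩
    obtain ⟨hx, hy⟩ := h1 htT
    have hγ := hx.hasDerivAt.prodMk hy.hasDerivAt
    have hder := (hd (γ t)).comp_hasDerivAt t hγ
    have hd' : deriv (fun t => φ (γ t)) t = A (γ t) * deriv (fun u => (γ u).1) t +
        B (γ t) * deriv (fun u => (γ u).2) t := by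
      have := hder.deriv
      simpa [Function.comp_def] using this
    rw [hd']
    have h3 := hAB _ (h.pos t ⟨htT.1.le, htT.2⟩) (hR t ⟨htT.1.le, htT.2⟩)
    calc _ ≤ |A (γ t)| * |deriv (fun u => (γ u).1) t| +
          |B (γ t)| * |deriv (fun u => (γ u).2) t| := by
          rw [← abs_mul, ← abs_mul]; exact abs_add_le _ _
      _ ≤ |A (γ t)| * spd γ t + |B (γ t)| * spd γ t := by
          gcongr
          · exact abs_deriv_fst_le_spd γ t
          · exact abs_deriv_snd_le_spd γ t
      _ = (|A (γ t)| + |B (γ t)|) * spd γ t := by ring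
      _ ≤ (C * Fvol n cn (γ t)) * spd γ t := by gcongr; exact spd_nonneg _ _
      _ = C * hspd n cn γ t := by unfold hspd; ring
      _ ≤ C * M := by gcongr; exact h2 htT
  have := abs_sub_le_integral_of_abs_deriv_le hab hlip hae intervalIntegrable_const
  rw [intervalIntegral.integral_const, smul_eq_mul] at this
  linarith

end IsCurve

/-- A locally Lipschitz curve `[0,T) → P°` of `h`-speed at most `M` along which `xy → 0`. -/
structure IsBdryCurve (n : ℕ) (cn T M : ℝ) (γ : ℝ → ℝ × ℝ) : Prop extends IsCurve T γ where
  bound : ∀ᵐ t, t ∈ Ioo 0 T → hspd n cn γ t ≤ M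
  tendsto : Tendsto (fun t => (γ t).1 * (γ t).2) (𝓝[<] T) (𝓝 0)

theorem memRh_iff {n : ℕ} {cn x0 y0 : ℝ} {γ : ℝ → ℝ × ℝ} :
    MemRh n cn x0 y0 γ ↔ γ 0 = (x0, y0) ∧ ∃ M, IsBdryCurve n cn 1 M γ := by
  have hae : ∀ M : ℝ, (∀ᵐ t ∂(volume : Measure ℝ), t ∈ Ico (0:ℝ) 1 → hSpeed n cn γ t ≤ M) ↔
      ∀ᵐ t, t ∈ Ioo 0 1 → hspd n cn γ t ≤ M := by
    intro M
    have h0 : ∀ᵐ t : ℝ, t ≠ 0 := by simp [ae_iff]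
    constructor <;> intro h
    · filter_upwards [h] with t h1 ht
      rw [← hSpeedOn_Ico_eq n cn γ ht]
      exact h1 ⟨ht.1.le, ht.2⟩
    · filter_upwards [h, h0] with t h1 h2 ht
      have ht' : t ∈ Ioo (0:ℝ) 1 := ⟨lt_of_le_of_ne ht.1 h2.symm, ht.2⟩
      unfold hSpeed
      rw [hSpeedOn_Ico_eq n cn γ ht']
      exact h1 ht'
  constructor
  · rintro ⟨h0, hpos, hlip, ⟨M, hM⟩, ht⟩
    exact ⟨h0, M, ⟨⟨hpos, hlip⟩, (hae M).1 hM, ht⟩⟩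
  · rintro ⟨h0, M, h⟩
    exact ⟨h0, h.pos, h.lip, ⟨M, (hae M).2 h.bound⟩, h.tendsto⟩

/-- The numerator of the `h`-Rayleigh quotient, with two-sided derivatives. -/
def rayleighNum (n : ℕ) (cn p : ℝ) (γ : ℝ → ℝ × ℝ) (w : ℝ → ℝ) (t : ℝ) : ℝ :=
  |deriv w t| ^ p * Fvol n cn (γ t) ^ p * hspd n cn γ t ^ (1 - p)

/-- The constant `c` bounds the `h`-Rayleigh quotients of the curve from below. -/
def RayleighBound (n : ℕ) (cn p : ℝ) (γ : ℝ → ℝ × ℝ) (c : ℝ) : Prop :=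
  ∀ w : ℝ → ℝ, (∃ K, LipschitzWith K w) → w 0 = 0 →
    IntegrableOn (rayleighNum n cn p γ w) (Ioo 0 1) →
    c * ∫ t in Ioo (0:ℝ) 1, |w t| ^ p * hspd n cn γ t ≤
      ∫ t in Ioo (0:ℝ) 1, rayleighNum n cn p γ w t

/-- Lower bound `c` for the Rayleigh quotients of a curve of constant speed `L`. -/
def WeightedBound (n : ℕ) (cn p : ℝ) (γ : ℝ → ℝ × ℝ) (c L : ℝ) : Prop :=
  ∀ w : ℝ → ℝ, (∃ K, LipschitzWith K w) → w 0 = 0 →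
    c * L ^ p * ∫ t in Ioo (0:ℝ) 1, |w t| ^ p ≤
      ∫ t in Ioo (0:ℝ) 1, |deriv w t| ^ p * Fvol n cn (γ t) ^ p

theorem integrableOn_rpow_mul_hspd {n : ℕ} {cn p M : ℝ} (hcn : 0 < cn) (hp : 0 ≤ p)
    {γ : ℝ → ℝ × ℝ} (hγ : IsBdryCurve n cn 1 M γ) {w : ℝ → ℝ} (hw : Continuous w) :
    IntegrableOn (fun t => |w t| ^ p * hspd n cn γ t) (Ioo 0 1) := by
  have hcont : Continuous fun t => |w t| ^ p := hw.abs.rpow_const (fun _ => Or.inr hp)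
  obtain ⟨B, hB⟩ := (isCompact_Icc (a := (0:ℝ)) (b := 1)).bddAbove_image hcont.continuousOn
  refine Integrable.of_bound
    (hcont.aestronglyMeasurable.mul (hγ.aestronglyMeasurable_hspd n cn)) (B * M) ?_
  rw [ae_restrict_iff' measurableSet_Ioo]
  filter_upwards [hγ.bound] with t ht hT
  have h1 := hspd_nonneg (n := n) hcn (hγ.pos t ⟨hT.1.le, hT.2⟩)
  have h2 : |w t| ^ p ≤ B := hB (mem_image_of_mem _ ⟨hT.1.le, hT.2.le⟩)
  have h3 : 0 ≤ |w t| ^ p := by positivity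
  rw [Real.norm_eq_abs, abs_of_nonneg (mul_nonneg h3 h1)]
  exact mul_le_mul h2 (ht hT) h1 (h3.trans h2)

theorem lambdaH_nonneg {n : ℕ} {cn p x0 y0 : ℝ} (hcn : 0 < cn) {γ : ℝ → ℝ × ℝ}
    (hγ : MemRh n cn x0 y0 γ) : 0 ≤ lambdaH n cn p γ := by
  apply Real.sInf_nonneg
  rintro q ⟨w, -, -, -, -, hden, rfl⟩
  refine div_nonneg ?_ hden.le
  rw [intervalIntegral.integral_of_le zero_le_one, integral_Ioc_eq_integral_Ioo]
  apply setIntegral_nonneg measurableSet_Ioo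
  intro t ht
  unfold numH
  have h1 := hγ.2.1 t ⟨ht.1.le, ht.2⟩
  have h2 : 0 ≤ hSpeedOn n cn (Ico 0 1) γ t := by
    rw [hSpeedOn_Ico_eq n cn γ ht]; exact hspd_nonneg hcn h1
  have h3 := (Fvol_pos (n := n) hcn h1).le
  positivity

theorem rayleighBound_lambdaH {n : ℕ} {cn p x0 y0 : ℝ} (hcn : 0 < cn) (hp : 1 < p)
    {γ : ℝ → ℝ × ℝ} (hγ : MemRh n cn x0 y0 γ) :
    RayleighBound n cn p γ (lambdaH n cn p γ) := by
  obtain ⟨h0, M, hM⟩ := memRh_iff.1 hγ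
  rintro w ⟨K, hK⟩ hw0 hint
  have hnum : EqOn (numH n cn p 0 1 (Ico 0 1) γ w) (rayleighNum n cn p γ w) (Ioo 0 1) := by
    intro t ht
    unfold numH rayleighNum
    rw [hSpeedOn_Ico_eq n cn γ ht, derivWithin_of_mem_nhds (Icc_mem_nhds ht.1 ht.2)]
  have hden : EqOn (denH n cn p (Ico 0 1) γ w) (fun t => |w t| ^ p * hspd n cn γ t)
      (Ioo 0 1) := by
    intro t ht
    unfold denH
    rw [hSpeedOn_Ico_eq n cn γ ht]
  have hnn : ∀ t ∈ Ioo (0:ℝ) 1, 0 ≤ rayleighNum n cn p γ w t := by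
    intro t ht
    have h1 := hγ.2.1 t ⟨ht.1.le, ht.2⟩
    have h2 := hspd_nonneg (n := n) hcn h1
    have h3 := (Fvol_pos (n := n) hcn h1).le
    unfold rayleighNum
    positivity
  have hN : 0 ≤ ∫ t in Ioo (0:ℝ) 1, rayleighNum n cn p γ w t :=
    setIntegral_nonneg measurableSet_Ioo hnn
  have hD : 0 ≤ ∫ t in Ioo (0:ℝ) 1, |w t| ^ p * hspd n cn γ t := by
    refine setIntegral_nonneg measurableSet_Ioo fun t ht => ?_
    have := hspd_nonneg (n := n) hcn (hγ.2.1 t ⟨ht.1.le, ht.2⟩)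
    positivity
  rcases hD.eq_or_lt with hD | hD
  · rw [← hD, mul_zero]; exact hN
  have hNi : (∫ t in (0:ℝ)..1, numH n cn p 0 1 (Ico 0 1) γ w t) =
      ∫ t in Ioo (0:ℝ) 1, rayleighNum n cn p γ w t := by
    rw [intervalIntegral.integral_of_le zero_le_one, integral_Ioc_eq_integral_Ioo]
    exact setIntegral_congr_fun measurableSet_Ioo hnum
  have hDi : (∫ t in (0:ℝ)..1, denH n cn p (Ico 0 1) γ w t) =
      ∫ t in Ioo (0:ℝ) 1, |w t| ^ p * hspd n cn γ t := by
    rw [intervalIntegral.integral_of_le zero_le_one, integral_Ioc_eq_integral_Ioo]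
    exact setIntegral_congr_fun measurableSet_Ioo hden
  rw [← le_div_iff₀ hD]
  refine csInf_le ⟨0, ?_⟩ ⟨w, ⟨K, hK.lipschitzOnWith⟩, hw0, ?_, ?_, ?_, ?_⟩
  · rintro q ⟨w', -, -, -, -, hden', rfl⟩
    refine div_nonneg ?_ hden'.le
    rw [intervalIntegral.integral_of_le zero_le_one, integral_Ioc_eq_integral_Ioo]
    apply setIntegral_nonneg measurableSet_Ioo
    intro t ht
    unfold numH
    have h1 := hγ.2.1 t ⟨ht.1.le, ht.2⟩
    have h2 : 0 ≤ hSpeedOn n cn (Ico 0 1) γ t := by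
      rw [hSpeedOn_Ico_eq n cn γ ht]; exact hspd_nonneg hcn h1
    have h3 := (Fvol_pos (n := n) hcn h1).le
    positivity
  · rw [intervalIntegrable_iff_integrableOn_Ioo_of_le zero_le_one]
    exact hint.congr_fun hnum.symm measurableSet_Ioo
  · rw [intervalIntegrable_iff_integrableOn_Ioo_of_le zero_le_one]
    exact (integrableOn_rpow_mul_hspd hcn (by linarith) hM hK.continuous).congr_fun hden.symm
      measurableSet_Ioo
  · rwa [hDi]
  · rw [hNi, hDi]

theorem le_lambdaH {n : ℕ} {cn p c L x0 y0 : ℝ} (hcn : 0 < cn) (hp : 1 < p) (hL : 0 < L)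
    {γ : ℝ → ℝ × ℝ} (hγ : MemRh n cn x0 y0 γ)
    (hspeed : ∀ᵐ t, t ∈ Ioo (0:ℝ) 1 → hspd n cn γ t = L)
    (hFb : ∃ B, ∀ t ∈ Ioo (0:ℝ) 1, Fvol n cn (γ t) ≤ B)
    (hb : WeightedBound n cn p γ c L) : c ≤ lambdaH n cn p γ := by
  obtain ⟨h0, M, hM⟩ := memRh_iff.1 hγ
  obtain ⟨B, hB⟩ := hFb
  have hsp := (ae_restrict_iff' (μ := volume) measurableSet_Ioo).2 hspeed
  have hnum : ∀ w : ℝ → ℝ, numH n cn p 0 1 (Ico 0 1) γ w =ᵐ[volume.restrict (Ioo 0 1)]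
      fun t => L ^ (1 - p) * (|deriv w t| ^ p * Fvol n cn (γ t) ^ p) := by
    intro w
    filter_upwards [hsp, ae_restrict_mem measurableSet_Ioo] with t h1 ht
    unfold numH
    rw [hSpeedOn_Ico_eq n cn γ ht, derivWithin_of_mem_nhds (Icc_mem_nhds ht.1 ht.2), h1]
    ring
  have hden : ∀ w : ℝ → ℝ, denH n cn p (Ico 0 1) γ w =ᵐ[volume.restrict (Ioo 0 1)]
      fun t => L * |w t| ^ p := by
    intro w
    filter_upwards [hsp, ae_restrict_mem measurableSet_Ioo] with t h1 ht
    unfold denH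
    rw [hSpeedOn_Ico_eq n cn γ ht, h1]
    ring
  have hI : ∀ f : ℝ → ℝ, (∫ t in (0:ℝ)..1, f t) = ∫ t in Ioo (0:ℝ) 1, f t := by
    intro f
    rw [intervalIntegral.integral_of_le zero_le_one, integral_Ioc_eq_integral_Ioo]
  apply le_csInf
  · refine ⟨_, fun t => t, ⟨1, LipschitzWith.id.lipschitzOnWith⟩, rfl, ?_, ?_, ?_, rfl⟩
    · rw [intervalIntegrable_iff_integrableOn_Ioo_of_le zero_le_one]
      refine Integrable.congr ?_ (hnum _).symm
      refine Integrable.of_bound ?_ (L ^ (1 - p) * B ^ p) ?_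
      · simp only [deriv_id'', abs_one, Real.one_rpow, one_mul]
        exact (hM.aestronglyMeasurable_comp (f := fun z => Fvol n cn z ^ p)
          ((continuous_Fvol n cn).rpow_const
          (fun _ => Or.inr (by linarith)))).const_mul _
      · filter_upwards [ae_restrict_mem measurableSet_Ioo] with t ht
        have hF := Fvol_pos (n := n) hcn (hγ.2.1 t ⟨ht.1.le, ht.2⟩)
        simp only [deriv_id'', abs_one, Real.one_rpow, one_mul]
        rw [Real.norm_of_nonneg (by positivity)]
        gcongr
        exact hB t ht
    · rw [intervalIntegrable_iff_integrableOn_Ioo_of_le zero_le_one]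
      refine Integrable.congr ?_ (hden _).symm
      have : Continuous fun t : ℝ => L * |t| ^ p :=
        continuous_const.mul (continuous_abs.rpow_const (fun _ => Or.inr (by linarith)))
      exact (this.integrableOn_Icc (a := 0) (b := 1)).mono_set Ioo_subset_Icc_self
    · rw [hI, integral_congr_ae (hden _), ← hI]
      have : Continuous fun t : ℝ => L * |t| ^ p :=
        continuous_const.mul (continuous_abs.rpow_const (fun _ => Or.inr (by linarith)))
      refine intervalIntegral.intervalIntegral_pos_of_pos_on (this.intervalIntegrable _ _) ?_
        zero_lt_one
      intro t ht
      have : 0 < |t| := abs_pos.2 ht.1.ne'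
      positivity
  · rintro q ⟨w, ⟨K, hK⟩, hw0, -, -, hden', rfl⟩
    rw [le_div_iff₀ hden']
    obtain ⟨w', hw', heq⟩ := hK.extend_real
    have key := hb w' ⟨K, hw'⟩ (by rw [← heq ⟨le_rfl, zero_le_one⟩, hw0])
    have e1 : (∫ t in Ioo (0:ℝ) 1, |w' t| ^ p) = ∫ t in Ioo (0:ℝ) 1, |w t| ^ p :=
      setIntegral_congr_fun measurableSet_Ioo fun t ht => by
        simp only [heq ⟨ht.1.le, ht.2.le⟩]
    have e2 : (∫ t in Ioo (0:ℝ) 1, |deriv w' t| ^ p * Fvol n cn (γ t) ^ p) =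
        ∫ t in Ioo (0:ℝ) 1, |deriv w t| ^ p * Fvol n cn (γ t) ^ p :=
      setIntegral_congr_fun measurableSet_Ioo fun t ht => by
        have : w' =ᶠ[𝓝 t] w := by
          filter_upwards [Icc_mem_nhds ht.1 ht.2] with s hs using (heq hs).symm
        simp only [this.deriv_eq]
    rw [e1, e2] at key
    rw [hI, hI, integral_congr_ae (hnum _), integral_congr_ae (hden _), integral_const_mul,
      integral_const_mul]
    have hLp : L ^ (1 - p) * L ^ p = L := by
      rw [← Real.rpow_add hL]; simp
    calc c * (L * ∫ t in Ioo (0:ℝ) 1, |w t| ^ p)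
        = L ^ (1 - p) * (c * L ^ p * ∫ t in Ioo (0:ℝ) 1, |w t| ^ p) := by
          linear_combination (-(c * ∫ t in Ioo (0:ℝ) 1, |w t| ^ p)) * hLp
      _ ≤ _ := by gcongr

theorem IsCurve.comp_lip {T : ℝ} {γ : ℝ → ℝ × ℝ} (h : IsCurve T γ) {g : ℝ × ℝ → ℝ × ℝ}
    (hg : LocallyLipschitz g) {a : ℝ} (ha : a ∈ Ico 0 T) :
    ∃ K, LipschitzOnWith K (fun t => g (γ t)) (Icc 0 a) := by
  obtain ⟨K, hK⟩ := h.lip a ha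
  obtain ⟨K', hK'⟩ := hg.locallyLipschitzOn.exists_lipschitzOnWith_of_compact
    (isCompact_Icc.image_of_continuousOn hK.continuousOn)
  exact ⟨K' * K, hK'.comp hK (mapsTo_image _ _)⟩

/-- The scaling factor of the map that is the identity on the disc of radius `R` and the
inversion in its boundary circle outside. -/
def foldFactor (R : ℝ) (z : ℝ × ℝ) : ℝ := R ^ 2 / max (R ^ 2) (z.1 ^ 2 + z.2 ^ 2)

/-- The identity on the disc of radius `R`, the inversion in its boundary circle outside. -/
def fold (R : ℝ) (z : ℝ × ℝ) : ℝ × ℝ := (foldFactor R z * z.1, foldFactor R z * z.2)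

theorem foldFactor_pos {R : ℝ} (hR : 0 < R) (z : ℝ × ℝ) : 0 < foldFactor R z := by
  have : 0 < max (R ^ 2) (z.1 ^ 2 + z.2 ^ 2) := lt_max_of_lt_left (by positivity)
  unfold foldFactor
  positivity

theorem foldFactor_le_one {R : ℝ} (hR : 0 < R) (z : ℝ × ℝ) : foldFactor R z ≤ 1 := by
  have : 0 < max (R ^ 2) (z.1 ^ 2 + z.2 ^ 2) := lt_max_of_lt_left (by positivity)
  unfold foldFactor
  rw [div_le_one this]
  exact le_max_left _ _

theorem foldFactor_of_le {R : ℝ} (hR : 0 < R) {z : ℝ × ℝ} (hz : z.1 ^ 2 + z.2 ^ 2 ≤ R ^ 2) :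
    foldFactor R z = 1 := by
  unfold foldFactor
  rw [max_eq_left hz, div_self (by positivity)]

theorem foldFactor_of_ge {R : ℝ} {z : ℝ × ℝ} (hz : R ^ 2 ≤ z.1 ^ 2 + z.2 ^ 2) :
    foldFactor R z = R ^ 2 / (z.1 ^ 2 + z.2 ^ 2) := by
  unfold foldFactor
  rw [max_eq_right hz]

theorem fold_norm_le {R : ℝ} (hR : 0 < R) (z : ℝ × ℝ) :
    (fold R z).1 ^ 2 + (fold R z).2 ^ 2 ≤ R ^ 2 := by
  rcases le_total (z.1 ^ 2 + z.2 ^ 2) (R ^ 2) with h | h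
  · simpa [fold, foldFactor_of_le hR h] using h
  · have h0 : 0 < z.1 ^ 2 + z.2 ^ 2 := lt_of_lt_of_le (by positivity) h
    simp only [fold, foldFactor_of_ge h]
    have : (R ^ 2 / (z.1 ^ 2 + z.2 ^ 2) * z.1) ^ 2 + (R ^ 2 / (z.1 ^ 2 + z.2 ^ 2) * z.2) ^ 2 =
        R ^ 2 * (R ^ 2 / (z.1 ^ 2 + z.2 ^ 2)) := by
      field_simp
    rw [this]
    have : R ^ 2 / (z.1 ^ 2 + z.2 ^ 2) ≤ 1 := (div_le_one h0).2 h
    nlinarith [sq_nonneg R]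

theorem locallyLipschitz_fold {R : ℝ} (hR : 0 < R) : LocallyLipschitz (fold R) := by
  have hk : LipschitzWith (Real.toNNReal (1 / R ^ 2)) (fun s : ℝ => R ^ 2 / max (R ^ 2) s) := by
    apply LipschitzWith.of_dist_le_mul
    intro a b
    rw [Real.coe_toNNReal _ (by positivity), Real.dist_eq, Real.dist_eq]
    have ha : R ^ 2 ≤ max (R ^ 2) a := le_max_left _ _
    have hb : R ^ 2 ≤ max (R ^ 2) b := le_max_left _ _
    have hR2 : 0 < R ^ 2 := by positivity
    have hab : |max (R ^ 2) b - max (R ^ 2) a| ≤ |a - b| := by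
      rw [abs_sub_comm a b, max_comm, max_comm _ a]; exact abs_max_sub_max_le_abs _ _ _
    rw [div_sub_div _ _ (by linarith) (by linarith), abs_div,
      mul_comm (max (R ^ 2) a) (R ^ 2), ← mul_sub, abs_mul,
      abs_of_pos hR2, abs_of_pos (by nlinarith : 0 < max (R ^ 2) a * max (R ^ 2) b),
      div_le_iff₀ (by nlinarith)]
    have h1 : R ^ 2 * R ^ 2 ≤ max (R ^ 2) a * max (R ^ 2) b := by gcongr
    calc R ^ 2 * |max (R ^ 2) b - max (R ^ 2) a| ≤ R ^ 2 * |a - b| := by gcongr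
      _ = 1 / R ^ 2 * |a - b| * (R ^ 2 * R ^ 2) := by field_simp
      _ ≤ _ := by gcongr
  have hρ : LocallyLipschitz (fun z : ℝ × ℝ => z.1 ^ 2 + z.2 ^ 2) := by
    apply ContDiff.locallyLipschitz (𝕂 := ℝ)
    fun_prop
  have hm : LocallyLipschitz (foldFactor R) := hk.locallyLipschitz.comp hρ
  have hs : LocallyLipschitz (fun q : (ℝ × ℝ) × ℝ => (q.2 * q.1.1, q.2 * q.1.2)) := by
    apply ContDiff.locallyLipschitz (𝕂 := ℝ)
    fun_prop
  exact hs.comp (LocallyLipschitz.id.prodMk hm)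

theorem isCurve_fold {T R : ℝ} (hR : 0 < R) {γ : ℝ → ℝ × ℝ} (h : IsCurve T γ) :
    IsCurve T (fun t => fold R (γ t)) where
  pos t ht := by
    obtain ⟨h1, h2⟩ := h.pos t ht
    have := foldFactor_pos hR (γ t)
    exact ⟨mul_pos this h1, mul_pos this h2⟩
  lip a ha := h.comp_lip (locallyLipschitz_fold hR) ha

theorem ae_spd_fold {T R : ℝ} (hR : 0 < R) {γ : ℝ → ℝ × ℝ} (h : IsCurve T γ) :
    ∀ᵐ t, t ∈ Ioo 0 T → spd (fun t => fold R (γ t)) t = foldFactor R (γ t) * spd γ t := by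
  filter_upwards [h.ae_differentiableAt, (isCurve_fold hR h).ae_differentiableAt]
    with t h1 h2 ht
  obtain ⟨hx, hy⟩ := h1 ht
  obtain ⟨hx', hy'⟩ := h2 ht
  have hm0 := foldFactor_pos hR (γ t)
  rcases le_or_gt ((γ t).1 ^ 2 + (γ t).2 ^ 2) (R ^ 2) with hle | hgt
  · have hxne : (γ t).1 ≠ 0 := (h.pos t ⟨ht.1.le, ht.2⟩).1.ne'
    have hev : (fun s => foldFactor R (γ s)) =ᶠ[𝓝 t]
        fun s => (fold R (γ s)).1 / (γ s).1 := by
      filter_upwards [Ioo_mem_nhds ht.1 ht.2] with s hs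
      have : (γ s).1 ≠ 0 := (h.pos s ⟨hs.1.le, hs.2⟩).1.ne'
      simp only [fold]
      field_simp
    have hmd : DifferentiableAt ℝ (fun s => foldFactor R (γ s)) t :=
      (hx'.div hx hxne).congr_of_eventuallyEq hev
    have hm1 := foldFactor_of_le hR hle
    have hmax : IsLocalMax (fun s => foldFactor R (γ s)) t := by
      refine Eventually.of_forall fun s => ?_
      show foldFactor R (γ s) ≤ foldFactor R (γ t)
      rw [hm1]
      exact foldFactor_le_one hR _
    have hm' := hmd.hasDerivAt
    rw [hmax.deriv_eq_zero] at hm'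
    have e1 := (hm'.mul hx.hasDerivAt).deriv
    have e2 := (hm'.mul hy.hasDerivAt).deriv
    rw [hm1] at e1 e2
    have e1' : deriv (fun u => (fold R (γ u)).1) t = deriv (fun u => (γ u).1) t := by
      refine Eq.trans ?_ (e1.trans ?_)
      · rfl
      · simp
    have e2' : deriv (fun u => (fold R (γ u)).2) t = deriv (fun u => (γ u).2) t := by
      refine Eq.trans ?_ (e2.trans ?_)
      · rfl
      · simp
    unfold spd
    rw [e1', e2', hm1, one_mul]
  · have hρ : 0 < (γ t).1 ^ 2 + (γ t).2 ^ 2 := lt_trans (by positivity) hgt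
    have hcont : ContinuousAt (fun s => (γ s).1 ^ 2 + (γ s).2 ^ 2) t :=
      (hx.continuousAt.pow 2).add (hy.continuousAt.pow 2)
    have hev : ∀ᶠ s in 𝓝 t, fold R (γ s) =
        (R ^ 2 / ((γ s).1 ^ 2 + (γ s).2 ^ 2) * (γ s).1,
          R ^ 2 / ((γ s).1 ^ 2 + (γ s).2 ^ 2) * (γ s).2) := by
      filter_upwards [hcont.eventually_const_lt hgt] with s hs
      simp only [fold, foldFactor_of_ge hs.le]
    have hq := ((hasDerivAt_const t (R ^ 2)).div
      ((hx.hasDerivAt.pow 2).add (hy.hasDerivAt.pow 2)) hρ.ne')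
    have e1 : deriv (fun u => (fold R (γ u)).1) t = _ :=
      (EventuallyEq.deriv_eq (hev.mono fun s hs => congrArg Prod.fst hs)).trans
        (hq.mul hx.hasDerivAt).deriv
    have e2 : deriv (fun u => (fold R (γ u)).2) t = _ :=
      (EventuallyEq.deriv_eq (hev.mono fun s hs => congrArg Prod.snd hs)).trans
        (hq.mul hy.hasDerivAt).deriv
    unfold spd
    rw [e1, e2]
    rw [← Real.sqrt_sq hm0.le, ← Real.sqrt_mul (sq_nonneg _)]
    congr 1
    rw [foldFactor_of_ge hgt.le]
    simp only [Pi.add_apply, Pi.pow_apply, Pi.div_apply]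
    generalize deriv (fun u => (γ u).1) t = a at *
    generalize deriv (fun u => (γ u).2) t = b at *
    generalize (γ t).1 = x at *
    generalize (γ t).2 = y at *
    field_simp
    push_cast
    ring

theorem Fvol_fold (n : ℕ) (cn R : ℝ) (z : ℝ × ℝ) :
    Fvol n cn (fold R z) = foldFactor R z ^ (2 * (n - 1)) * Fvol n cn z := by
  simp only [Fvol, fold, mul_pow, two_mul, pow_add]
  ring

theorem ae_hspd_fold {T R : ℝ} (hR : 0 < R) (n : ℕ) (cn : ℝ) {γ : ℝ → ℝ × ℝ}
    (h : IsCurve T γ) :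
    ∀ᵐ t, t ∈ Ioo 0 T → hspd n cn (fun t => fold R (γ t)) t =
      foldFactor R (γ t) ^ (2 * (n - 1) + 1) * hspd n cn γ t := by
  filter_upwards [ae_spd_fold hR h] with t h1 ht
  unfold hspd
  rw [h1 ht, Fvol_fold, pow_succ]
  ring

theorem isBdryCurve_fold {n : ℕ} {cn T M R : ℝ} (hcn : 0 < cn) (hR : 0 < R) {γ : ℝ → ℝ × ℝ}
    (hT : 0 < T) (h : IsBdryCurve n cn T M γ) :
    IsBdryCurve n cn T M (fun t => fold R (γ t)) where
  toIsCurve := isCurve_fold hR h.toIsCurve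
  bound := by
    filter_upwards [ae_hspd_fold hR n cn h.toIsCurve, h.bound] with t h1 h2 ht
    rw [h1 ht]
    refine le_trans ?_ (h2 ht)
    exact mul_le_of_le_one_left (hspd_nonneg hcn (h.pos t ⟨ht.1.le, ht.2⟩))
      (pow_le_one₀ (foldFactor_pos hR _).le (foldFactor_le_one hR _))
  tendsto := by
    refine squeeze_zero' ?_ ?_ h.tendsto
    · filter_upwards [Ioo_mem_nhdsLT hT] with t ht
      obtain ⟨h1, h2⟩ := (isCurve_fold hR h.toIsCurve).pos t ⟨ht.1.le, ht.2⟩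
      exact (mul_pos h1 h2).le
    · filter_upwards [Ioo_mem_nhdsLT hT] with t ht
      obtain ⟨h1, h2⟩ := h.pos t ⟨ht.1.le, ht.2⟩
      have h3 := (foldFactor_pos hR (γ t)).le
      have h4 := foldFactor_le_one hR (γ t)
      simp only [fold]
      calc _ = (foldFactor R (γ t) * foldFactor R (γ t)) * ((γ t).1 * (γ t).2) := by ring
        _ ≤ 1 * ((γ t).1 * (γ t).2) := by
          gcongr
          exact mul_le_one₀ h4 h3 h4
        _ = _ := one_mul _

theorem rayleighBound_fold {n : ℕ} {cn p c M R : ℝ} (hn : 2 ≤ n) (hcn : 0 < cn) (hR : 0 < R)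
    (hp : 2 * (n : ℝ) - 1 ≤ p) (hc : 0 ≤ c) {γ : ℝ → ℝ × ℝ} (h : IsBdryCurve n cn 1 M γ)
    (hb : RayleighBound n cn p γ c) : RayleighBound n cn p (fun t => fold R (γ t)) c := by
  have hn' : (2:ℝ) ≤ n := by exact_mod_cast hn
  have hp1 : 1 < p := by linarith
  rintro w ⟨K, hK⟩ hw0 hint
  have hfold := isBdryCurve_fold hcn hR one_pos h
  have hle : ∀ᵐ t ∂volume.restrict (Ioo (0:ℝ) 1), 0 ≤ rayleighNum n cn p γ w t ∧
      rayleighNum n cn p γ w t ≤ rayleighNum n cn p (fun t => fold R (γ t)) w t := by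
    rw [ae_restrict_iff' measurableSet_Ioo]
    filter_upwards [ae_hspd_fold hR n cn h.toIsCurve] with t h1 ht
    have hpos := h.pos t ⟨ht.1.le, ht.2⟩
    have hF := Fvol_pos (n := n) hcn hpos
    have hH := hspd_nonneg (n := n) hcn hpos
    have hm0 := foldFactor_pos hR (γ t)
    have hm1 := foldFactor_le_one hR (γ t)
    unfold rayleighNum
    refine ⟨by positivity, ?_⟩
    rw [h1 ht, Fvol_fold, Real.mul_rpow (by positivity) hF.le, Real.mul_rpow (by positivity) hH]
    have key : 1 ≤ (foldFactor R (γ t) ^ (2 * (n - 1))) ^ p *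
        (foldFactor R (γ t) ^ (2 * (n - 1) + 1)) ^ (1 - p) := by
      rw [← Real.rpow_natCast, ← Real.rpow_natCast, ← Real.rpow_mul hm0.le,
        ← Real.rpow_mul hm0.le, ← Real.rpow_add hm0]
      apply Real.one_le_rpow_of_pos_of_le_one_of_nonpos hm0 hm1
      push_cast [Nat.cast_sub (by omega : 1 ≤ n)]
      linarith
    generalize (foldFactor R (γ t) ^ (2 * (n - 1))) ^ p = A at *
    generalize (foldFactor R (γ t) ^ (2 * (n - 1) + 1)) ^ (1 - p) = B at *
    calc _ = 1 * (|deriv w t| ^ p * Fvol n cn (γ t) ^ p * hspd n cn γ t ^ (1 - p)) :=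
          (one_mul _).symm
      _ ≤ (A * B) * (|deriv w t| ^ p * Fvol n cn (γ t) ^ p * hspd n cn γ t ^ (1 - p)) := by
        gcongr
      _ = _ := by ring
  have hmeas : AEStronglyMeasurable (rayleighNum n cn p γ w) (volume.restrict (Ioo 0 1)) := by
    refine AEStronglyMeasurable.mul (AEStronglyMeasurable.mul ?_ ?_) ?_
    · exact (((measurable_deriv w).norm).pow_const p).aestronglyMeasurable
    · exact h.aestronglyMeasurable_comp (f := fun z => Fvol n cn z ^ p)
        ((continuous_Fvol n cn).rpow_const (fun _ => Or.inr (by linarith)))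
    · exact ((h.aestronglyMeasurable_hspd n cn).aemeasurable.pow_const _).aestronglyMeasurable
  have hint' : IntegrableOn (rayleighNum n cn p γ w) (Ioo 0 1) := by
    refine Integrable.mono' hint hmeas ?_
    filter_upwards [hle] with t ht
    rw [Real.norm_of_nonneg ht.1]
    exact ht.2
  calc _ ≤ c * ∫ t in Ioo (0:ℝ) 1, |w t| ^ p * hspd n cn γ t := by
        refine mul_le_mul_of_nonneg_left ?_ hc
        refine integral_mono_ae (integrableOn_rpow_mul_hspd hcn (by linarith) hfold hK.continuous)
          (integrableOn_rpow_mul_hspd hcn (by linarith) h hK.continuous) ?_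
        rw [EventuallyLE, ae_restrict_iff' measurableSet_Ioo]
        filter_upwards [ae_hspd_fold hR n cn h.toIsCurve] with t h1 ht
        simp only [h1 ht]
        gcongr
        exact mul_le_of_le_one_left (hspd_nonneg hcn (h.pos t ⟨ht.1.le, ht.2⟩))
          (pow_le_one₀ (foldFactor_pos hR _).le (foldFactor_le_one hR _))
    _ ≤ ∫ t in Ioo (0:ℝ) 1, rayleighNum n cn p γ w t := hb w ⟨K, hK⟩ hw0 hint'
    _ ≤ _ := integral_mono_ae hint' hint (hle.mono fun t ht => ht.2)

/-- The push-forward of a density `g` on `(0,T)` of total mass one under its primitive is the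
Lebesgue measure on the unit interval. -/
theorem map_primitive_withDensity {g τ : ℝ → ℝ} {T : ℝ} (hg : Integrable g)
    (hg0 : ∀ t, 0 ≤ g t) (hgs : ∀ t, t ∉ Ioo 0 T → g t = 0)
    (hτ : ∀ t, τ t = ∫ s in (0:ℝ)..t, g s) (hτT : τ T = 1) :
    Measure.map τ (volume.withDensity fun t => ENNReal.ofReal (g t)) =
      volume.restrict (Ioo 0 1) := by
  have hcont : Continuous τ := by
    rw [funext hτ]
    exact intervalIntegral.continuous_primitive (fun a b => hg.intervalIntegrable) 0
  have hsub : ∀ s t, τ t - τ s = ∫ u in s..t, g u := fun s t => by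
    rw [hτ, hτ, intervalIntegral.integral_interval_sub_left hg.intervalIntegrable
      hg.intervalIntegrable]
  have hmono : Monotone τ := fun s t hst => by
    have := intervalIntegral.integral_nonneg (μ := volume) hst (fun u _ => hg0 u)
    linarith [hsub s t]
  have hneg : ∀ t ≤ 0, τ t = 0 := fun t ht => by
    rw [hτ]
    refine intervalIntegral.integral_zero_ae (Eventually.of_forall fun s hs => hgs s fun h => ?_)
    rw [uIoc_of_ge ht] at hs
    exact absurd h.1 (not_lt.2 hs.2)
  have hlarge : ∀ t, T ≤ t → τ t = 1 := fun t ht => by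
    have : (∫ u in T..t, g u) = 0 := by
      refine intervalIntegral.integral_zero_ae (Eventually.of_forall fun s hs => hgs s fun h => ?_)
      rw [uIoc_of_le ht] at hs
      exact absurd h.2 (not_lt.2 hs.1.le)
    linarith [hsub T t]
  have : IsFiniteMeasure (volume.withDensity fun t => ENNReal.ofReal (g t)) :=
    isFiniteMeasure_withDensity_ofReal hg.hasFiniteIntegral
  have hIic : ∀ t, (volume.withDensity fun t => ENNReal.ofReal (g t)) (Iic t) =
      ENNReal.ofReal (τ t) := fun t => by
    rw [withDensity_apply _ measurableSet_Iic,
      ← ofReal_integral_eq_lintegral_ofReal hg.integrableOn (Eventually.of_forall hg0)]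
    congr 1
    rcases le_total 0 t with h | h
    · rw [hτ, intervalIntegral.integral_of_le h]
      refine (setIntegral_eq_of_subset_of_forall_sdiff_eq_zero measurableSet_Iic
        (fun s hs => hs.2) fun s hs => hgs s fun h' => hs.2 ⟨h'.1, hs.1⟩)
    · rw [hneg t h]
      exact setIntegral_eq_zero_of_forall_eq_zero fun s hs => hgs s fun h' =>
        absurd h'.1 (not_lt.2 (le_trans hs h))
  have : IsFiniteMeasure (Measure.map τ (volume.withDensity fun t => ENNReal.ofReal (g t))) :=
    Measure.isFiniteMeasure_map _ _
  refine Measure.ext_of_Iic _ _ fun a => ?_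
  rw [Measure.map_apply hcont.measurable measurableSet_Iic, restrict_Ioo_eq_restrict_Ioc,
    Measure.restrict_apply measurableSet_Iic]
  rcases lt_or_ge a 0 with ha | ha
  · have e1 : τ ⁻¹' Iic a = ∅ := by
      ext t
      have : 0 ≤ τ t := by
        rcases le_total 0 t with h | h
        · rw [← hneg 0 le_rfl]; exact hmono h
        · rw [hneg t h]
      simp only [mem_preimage, mem_Iic, mem_empty_iff_false, iff_false, not_le]
      linarith
    have e2 : Iic a ∩ Ioc (0:ℝ) 1 = ∅ := by
      ext t
      simp only [mem_inter_iff, mem_Iic, mem_Ioc, mem_empty_iff_false, iff_false]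
      rintro ⟨h1, h2, -⟩
      linarith
    rw [e1, e2]
    simp
  · rcases lt_or_ge a 1 with ha1 | ha1
    · have hne : (τ ⁻¹' Iic a).Nonempty := ⟨0, by simpa [hneg 0 le_rfl] using ha⟩
      have hbdd : BddAbove (τ ⁻¹' Iic a) := ⟨T, fun t ht => by
        by_contra! hlt
        have := hlarge t hlt.le
        rw [mem_preimage, mem_Iic] at ht
        linarith⟩
      have hcl : IsClosed (τ ⁻¹' Iic a) := isClosed_Iic.preimage hcont
      have hmem := hcl.csSup_mem hne hbdd
      set b := sSup (τ ⁻¹' Iic a) with hb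
      have e1 : τ ⁻¹' Iic a = Iic b := by
        ext t
        exact ⟨fun ht => le_csSup hbdd ht, fun ht => (hmono ht).trans hmem⟩
      have hτb : τ b = a := by
        refine le_antisymm hmem ?_
        have hbT : b ≤ T := by
          by_contra! hlt
          have := hlarge b hlt.le
          rw [mem_preimage, mem_Iic] at hmem
          linarith
        obtain ⟨t, -, ht⟩ := intermediate_value_Icc hbT hcont.continuousOn
          (show a ∈ Icc (τ b) (τ T) from ⟨hmem, by rw [hτT]; exact ha1.le⟩)
        have : t ≤ b := le_csSup hbdd (by simp [ht])
        rw [← ht]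
        exact hmono this
      have e2 : Iic a ∩ Ioc (0:ℝ) 1 = Ioc 0 a := by
        ext t
        simp only [mem_inter_iff, mem_Iic, mem_Ioc]
        exact ⟨fun h => ⟨h.2.1, h.1⟩, fun h => ⟨h.2, h.1, by linarith [h.2]⟩⟩
      rw [e1, hIic, hτb, e2, Real.volume_Ioc, sub_zero]
    · have e1 : τ ⁻¹' Iic a = univ := by
        ext t
        have : τ t ≤ 1 := by
          rcases le_total t T with h | h
          · rw [← hτT]; exact hmono h
          · rw [hlarge t h]
        simp only [mem_preimage, mem_Iic, mem_univ, iff_true]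
        linarith
      have e2 : Iic a ∩ Ioc (0:ℝ) 1 = Ioc 0 1 := by
        ext t
        simp only [mem_inter_iff, mem_Iic, mem_Ioc]
        exact ⟨fun h => h.2, fun h => ⟨by linarith [h.2], h⟩⟩
      have e3 : (volume.withDensity fun t => ENNReal.ofReal (g t)) univ = 1 := by
        have : (univ : Set ℝ) = Iic T ∪ Ioi T := by simp
        have h0 : (volume.withDensity fun t => ENNReal.ofReal (g t)) (Ioi T) = 0 := by
          rw [withDensity_apply _ measurableSet_Ioi]
          refine setLIntegral_eq_zero measurableSet_Ioi fun s hs => ?_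
          simp [hgs s fun h => absurd h.2 (not_lt.2 (le_of_lt hs))]
        refine le_antisymm ?_ ?_
        · rw [this]
          refine (measure_union_le _ _).trans ?_
          rw [h0, hIic, hτT]; simp
        · have := measure_mono (μ := volume.withDensity fun t => ENNReal.ofReal (g t))
            (subset_univ (Iic T))
          rw [hIic, hτT] at this
          simpa using this
      rw [e1, e2, e3]
      simp

/-- The density of the normalized `h`-arc length along a curve on `[0,T)`. -/
def arcDensity (n : ℕ) (cn T L : ℝ) (γ : ℝ → ℝ × ℝ) : ℝ → ℝ :=
  indicator (Ioo 0 T) fun t => hspd n cn γ t / L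

/-- The curve `η` on `[0,1)` is the reparametrization of the curve `γ` on `[0,T)`, of `h`-length
`L`, by its normalized `h`-arc length `τ`. -/
structure IsReparam (n : ℕ) (cn T L : ℝ) (γ : ℝ → ℝ × ℝ) (τ : ℝ → ℝ) (η : ℝ → ℝ × ℝ) : Prop where
  L_pos : 0 < L
  lip : ∃ K, LipschitzWith K τ
  zero : τ 0 = 0
  mem : ∀ t ∈ Ico 0 T, τ t ∈ Ico 0 1
  eq_one : ∀ t, T ≤ t → τ t = 1
  eq : ∀ t ∈ Ico 0 T, η (τ t) = γ t
  surj : ∀ s ∈ Ico (0:ℝ) 1, ∃ t ∈ Ico 0 T, τ t = s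
  integrable : Integrable (arcDensity n cn T L γ)
  ae_hasDerivAt : ∀ᵐ t, HasDerivAt τ (arcDensity n cn T L γ t) t
  map_eq : Measure.map τ (volume.withDensity fun t => ENNReal.ofReal (arcDensity n cn T L γ t)) =
    volume.restrict (Ioo 0 1)

theorem exists_pos_le_Fvol {n : ℕ} {cn T : ℝ} (hcn : 0 < cn) {γ : ℝ → ℝ × ℝ} (h : IsCurve T γ)
    {a : ℝ} (ha : a ∈ Ico 0 T) : ∃ m > 0, ∀ t ∈ Icc 0 a, m ≤ Fvol n cn (γ t) := by
  have hc : ContinuousOn (fun t => Fvol n cn (γ t)) (Icc 0 a) :=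
    (continuous_Fvol n cn).comp_continuousOn
      (h.continuousOn.mono fun t ht => ⟨ht.1, ht.2.trans_lt ha.2⟩)
  obtain ⟨s, hs, hmin⟩ := isCompact_Icc.exists_isMinOn ⟨0, ⟨le_rfl, ha.1⟩⟩ hc
  exact ⟨_, Fvol_pos hcn (h.pos s ⟨hs.1, hs.2.trans_lt ha.2⟩), fun t ht => hmin ht⟩

theorem IsBdryCurve.integrable_indicator {n : ℕ} {cn T M : ℝ} (hcn : 0 < cn) {γ : ℝ → ℝ × ℝ}
    (h : IsBdryCurve n cn T M γ) : Integrable (indicator (Ioo 0 T) (hspd n cn γ)) := by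
  rw [integrable_indicator_iff measurableSet_Ioo]
  refine Integrable.of_bound (h.aestronglyMeasurable_hspd n cn) M ?_
  rw [ae_restrict_iff' measurableSet_Ioo]
  filter_upwards [h.bound] with t ht hT
  rw [Real.norm_of_nonneg (hspd_nonneg hcn (h.pos t ⟨hT.1.le, hT.2⟩))]
  exact ht hT

theorem indicator_hspd_nonneg {n : ℕ} {cn T : ℝ} (hcn : 0 < cn) {γ : ℝ → ℝ × ℝ}
    (h : IsCurve T γ) (t : ℝ) : 0 ≤ indicator (Ioo 0 T) (hspd n cn γ) t :=
  indicator_nonneg (fun s hs => hspd_nonneg hcn (h.pos s ⟨hs.1.le, hs.2⟩)) t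

/-- The displacement of a curve is controlled by its `h`-length away from the boundary. -/
theorem IsBdryCurve.dist_le {n : ℕ} {cn T M : ℝ} (hcn : 0 < cn) {γ : ℝ → ℝ × ℝ}
    (h : IsBdryCurve n cn T M γ) {m s t : ℝ} (hm : 0 < m) (hs : 0 ≤ s) (hst : s ≤ t) (ht : t < T)
    (hF : ∀ u ∈ Icc s t, m ≤ Fvol n cn (γ u)) :
    dist (γ t) (γ s) ≤ (∫ u in s..t, indicator (Ioo 0 T) (hspd n cn γ) u) / m := by
  have hint := (h.integrable_indicator hcn).intervalIntegrable (a := s) (b := t)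
  have ha : t ∈ Ico 0 T := ⟨hs.trans hst, ht⟩
  have hle : ∀ u ∈ Ioo s t, spd γ u ≤ indicator (Ioo 0 T) (hspd n cn γ) u / m := fun u hu => by
    rw [indicator_of_mem (show u ∈ Ioo 0 T from ⟨hs.trans_lt hu.1, hu.2.trans ht⟩),
      le_div_iff₀ hm, mul_comm, hspd]
    exact mul_le_mul_of_nonneg_right (hF u ⟨hu.1.le, hu.2.le⟩) (spd_nonneg _ _)
  rw [Prod.dist_eq, Real.dist_eq, Real.dist_eq, ← intervalIntegral.integral_div]
  refine max_le ?_ ?_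
  · obtain ⟨K, hK⟩ := h.lip_fst ha
    exact abs_sub_le_integral_of_abs_deriv_le hst (hK.mono (Icc_subset_Icc_left hs))
      (Eventually.of_forall fun u hu => (abs_deriv_fst_le_spd γ u).trans (hle u hu))
      (hint.div_const m)
  · obtain ⟨K, hK⟩ := h.lip_snd ha
    exact abs_sub_le_integral_of_abs_deriv_le hst (hK.mono (Icc_subset_Icc_left hs))
      (Eventually.of_forall fun u hu => (abs_deriv_snd_le_spd γ u).trans (hle u hu))
      (hint.div_const m)

theorem IsBdryCurve.exists_isReparam {n : ℕ} {cn T M : ℝ} (hcn : 0 < cn) (hT : 0 < T)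
    {γ : ℝ → ℝ × ℝ} (h : IsBdryCurve n cn T M γ) :
    ∃ L τ η, IsReparam n cn T L γ τ η ∧ IsCurve 1 η ∧
      Tendsto (fun t => (η t).1 * (η t).2) (𝓝[<] 1) (𝓝 0) := by
  set g := indicator (Ioo 0 T) (hspd n cn γ) with hg
  have hgi : Integrable g := h.integrable_indicator hcn
  have hg0 : ∀ t, 0 ≤ g t := indicator_hspd_nonneg hcn h.toIsCurve
  set ℓ : ℝ → ℝ := fun t => ∫ s in (0:ℝ)..t, g s with hℓ
  have hcont : Continuous ℓ :=
    intervalIntegral.continuous_primitive (fun a b => hgi.intervalIntegrable) 0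
  have hsub : ∀ s t, ∫ u in s..t, g u = ℓ t - ℓ s := fun s t =>
    (intervalIntegral.integral_interval_sub_left hgi.intervalIntegrable
      hgi.intervalIntegrable).symm
  have hmono : Monotone ℓ := fun s t hst => by
    have := intervalIntegral.integral_nonneg (μ := volume) hst (fun u _ => hg0 u)
    linarith [hsub s t]
  have hℓ0 : ℓ 0 = 0 := intervalIntegral.integral_same
  have hlarge : ∀ t, T ≤ t → ℓ t = ℓ T := fun t ht => by
    have : (∫ u in T..t, g u) = 0 := by
      refine intervalIntegral.integral_zero_ae (Eventually.of_forall fun s hs => ?_)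
      rw [uIoc_of_le ht] at hs
      exact indicator_of_notMem (fun h' => absurd h'.2 (not_lt.2 hs.1.le)) _
    linarith [hsub T t]
  have hinj : ∀ s ∈ Ico 0 T, ∀ t ∈ Ico 0 T, ℓ s = ℓ t → γ s = γ t := by
    have key : ∀ s t, 0 ≤ s → s ≤ t → t < T → ℓ s = ℓ t → γ s = γ t := by
      intro s t hs hst ht he
      obtain ⟨m, hm, hF⟩ := exists_pos_le_Fvol (n := n) hcn h.toIsCurve ⟨hs.trans hst, ht⟩
      have := h.dist_le hcn hm hs hst ht (fun u hu => hF u ⟨hs.trans hu.1, hu.2⟩)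
      rw [hsub, he, sub_self, zero_div] at this
      exact (dist_le_zero.1 this).symm
    intro s hs t ht he
    rcases le_total s t with hst | hst
    · exact key s t hs.1 hst ht.2 he
    · exact (key t s ht.1 hst hs.2 he.symm).symm
  have hlt : ∀ t ∈ Ico 0 T, ℓ t < ℓ T := by
    intro t ht
    refine lt_of_le_of_ne (hmono ht.2.le) fun he => ?_
    have hconst : ∀ᶠ s in 𝓝[<] T, (γ s).1 * (γ s).2 = (γ t).1 * (γ t).2 := by
      filter_upwards [Ioo_mem_nhdsLT ht.2] with s hs
      rw [hinj s ⟨ht.1.trans hs.1.le, hs.2⟩ t ht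
        (le_antisymm ((hmono hs.2.le).trans he.ge) (hmono hs.1.le))]
    have := tendsto_nhds_unique (h.tendsto.congr' hconst) tendsto_const_nhds
    have hp := h.pos t ht
    exact (mul_pos hp.1 hp.2).ne this
  have hL : 0 < ℓ T := by rw [← hℓ0]; exact hlt 0 ⟨le_rfl, hT⟩
  set L := ℓ T with hLdef
  have hM : 0 ≤ M := by
    by_contra! hM
    have : ∀ᵐ t : ℝ, g t = 0 := by
      filter_upwards [h.bound] with t ht
      by_cases hmem : t ∈ Ioo 0 T
      · linarith [ht hmem, hspd_nonneg (n := n) hcn (h.pos t ⟨hmem.1.le, hmem.2⟩)]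
      · exact indicator_of_notMem hmem _
    have h0 : L = 0 :=
      intervalIntegral.integral_zero_ae (this.mono fun t ht _ => ht)
    linarith
  have hdens : ∀ t, arcDensity n cn T L γ t = g t / L := fun t => by
    simp only [arcDensity, hg, indicator]
    split_ifs <;> simp
  set τ : ℝ → ℝ := fun t => ℓ t / L with hτ
  have hsurj : ∀ s ∈ Ico (0:ℝ) 1, ∃ t ∈ Ico 0 T, τ t = s := by
    intro s hs
    obtain ⟨t, ht, he⟩ := intermediate_value_Icc hT.le hcont.continuousOn
      (show s * L ∈ Icc (ℓ 0) (ℓ T) from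
        ⟨by rw [hℓ0]; exact mul_nonneg hs.1 hL.le, by nlinarith [hs.2]⟩)
    refine ⟨t, ⟨ht.1, lt_of_le_of_ne ht.2 ?_⟩, ?_⟩
    · rintro rfl
      rw [← hLdef] at he
      nlinarith [hs.2]
    · simp only [hτ, he]; field_simp
  choose! θ hθ hτθ using hsurj
  have hτlt : ∀ s t, τ s < τ t → s < t := fun s t hst => by
    by_contra! hle
    exact absurd (div_le_div_of_nonneg_right (hmono hle) hL.le) (not_le.2 hst)
  have hmem : ∀ t ∈ Ico 0 T, τ t ∈ Ico (0:ℝ) 1 := fun t ht =>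
    ⟨div_nonneg (hℓ0 ▸ hmono ht.1) hL.le, (div_lt_one hL).2 (hlt t ht)⟩
  have hθle : ∀ s a, 0 ≤ s → s ≤ a → a < 1 → θ s ≤ θ a := fun s a hs hsa ha => by
    rcases hsa.eq_or_lt with rfl | hlt'
    · exact le_rfl
    · refine (hτlt _ _ ?_).le
      rwa [hτθ s ⟨hs, hsa.trans_lt ha⟩, hτθ a ⟨hs.trans hsa, ha⟩]
  refine ⟨L, τ, fun s => γ (θ s), ⟨hL, ?_, ?_, hmem, ?_, ?_, fun s hs => ⟨θ s, hθ s hs, hτθ s hs⟩,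
    ?_, ?_, ?_⟩, ⟨fun s hs => h.pos _ (hθ s hs), ?_⟩, ?_⟩
  · refine ⟨Real.toNNReal (M / L), LipschitzWith.of_dist_le_mul fun s t => ?_⟩
    have key : ∀ s t, s ≤ t → ℓ t - ℓ s ≤ M * (t - s) := fun s t hst => by
      rw [← hsub]
      calc ∫ u in s..t, g u ≤ ∫ _ in s..t, M := by
            refine intervalIntegral.integral_mono_ae hst hgi.intervalIntegrable
              intervalIntegrable_const ?_
            filter_upwards [h.bound] with u hu
            by_cases hmem : u ∈ Ioo 0 T
            · simpa only [hg, indicator_of_mem hmem] using hu hmem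
            · simpa only [hg, indicator_of_notMem hmem] using hM
        _ = M * (t - s) := by simp [mul_comm]
    rw [Real.coe_toNNReal _ (by positivity), Real.dist_eq, Real.dist_eq]
    simp only [hτ]
    rw [← sub_div, abs_div, abs_of_pos hL, div_mul_eq_mul_div]
    gcongr
    rcases le_total s t with hst | hst
    · rw [abs_sub_comm, abs_sub_comm s, abs_of_nonneg (sub_nonneg.2 (hmono hst)),
        abs_of_nonneg (sub_nonneg.2 hst)]
      exact key s t hst
    · rw [abs_of_nonneg (sub_nonneg.2 (hmono hst)), abs_of_nonneg (sub_nonneg.2 hst)]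
      exact key t s hst
  · simp [hτ, hℓ0]
  · intro t ht
    simp only [hτ, hlarge t ht]
    exact div_self hL.ne'
  · intro t ht
    refine hinj _ (hθ _ (hmem t ht)) t ht ?_
    have := hτθ _ (hmem t ht)
    simp only [hτ] at this ⊢
    field_simp at this
    exact this
  · rw [funext hdens]; exact hgi.div_const L
  · filter_upwards [LocallyIntegrable.ae_hasDerivAt_integral hgi.locallyIntegrable] with t ht
    rw [hdens]
    exact (ht 0).div_const L
  · refine map_primitive_withDensity (T := T) ?_ (fun t => ?_) (fun t ht => ?_) (fun t => ?_) ?_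
    · rw [funext hdens]; exact hgi.div_const L
    · rw [hdens]; exact div_nonneg (hg0 t) hL.le
    · exact indicator_of_notMem ht _
    · simp only [hdens, intervalIntegral.integral_div, hτ, hℓ]
    · exact div_self hL.ne'
  · intro a ha
    obtain ⟨m, hm, hF⟩ := exists_pos_le_Fvol (n := n) hcn h.toIsCurve (hθ a ha)
    have key : ∀ s t, 0 ≤ s → s ≤ t → t ≤ a → dist (γ (θ t)) (γ (θ s)) ≤ L / m * dist t s := by
      intro s t hs hst hta
      have hs1 : s ∈ Ico (0:ℝ) 1 := ⟨hs, (hst.trans hta).trans_lt ha.2⟩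
      have ht1 : t ∈ Ico (0:ℝ) 1 := ⟨hs.trans hst, hta.trans_lt ha.2⟩
      have := h.dist_le hcn hm (hθ s hs1).1 (hθle s t hs hst ht1.2) (hθ t ht1).2
        (fun u hu => hF u ⟨(hθ s hs1).1.trans hu.1,
          hu.2.trans (hθle t a ht1.1 hta ha.2)⟩)
      rw [hsub] at this
      have e1 := hτθ s hs1
      have e2 := hτθ t ht1
      simp only [hτ] at e1 e2
      rw [div_eq_iff hL.ne'] at e1 e2
      rw [e1, e2] at this
      rw [Real.dist_eq, abs_of_nonneg (sub_nonneg.2 hst)]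
      refine this.trans_eq ?_
      ring
    refine ⟨Real.toNNReal (L / m), LipschitzOnWith.of_dist_le_mul fun s hs t ht => ?_⟩
    rw [Real.coe_toNNReal _ (by positivity)]
    rcases le_total s t with hst | hst
    · rw [dist_comm, dist_comm s]
      exact key s t hs.1 hst ht.2
    · exact key t s ht.1 hst hs.2
  · rw [Metric.tendsto_nhds]
    intro ε hε
    have h1 := (Metric.tendsto_nhds.1 h.tendsto ε hε).and (Ioo_mem_nhdsLT hT)
    obtain ⟨b, hb, hbT⟩ := (mem_nhdsLT_iff_exists_Ioo_subset' hT).1 h1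
    have hc : (max b 0 + T) / 2 ∈ Ico 0 T := by
      have := max_lt hb hT
      constructor <;> linarith [le_max_right b 0]
    filter_upwards [Ioo_mem_nhdsLT (hmem _ hc).2] with s hs
    have hs1 : s ∈ Ico (0:ℝ) 1 := ⟨(hmem _ hc).1.trans hs.1.le, hs.2⟩
    refine (hbT (show θ s ∈ Ioo b T from ⟨?_, (hθ s hs1).2⟩)).1
    have h3 := hτlt ((max b 0 + T) / 2) (θ s) (by rw [hτθ s hs1]; exact hs.1)
    have := max_lt hb hT
    linarith [le_max_left b 0]

theorem LipschitzWith.hasDerivAt_comp_zero {w τ : ℝ → ℝ} {K : NNReal} (hw : LipschitzWith K w)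
    {t : ℝ} (hτ : HasDerivAt τ 0 t) : HasDerivAt (fun s => w (τ s)) 0 t := by
  rw [hasDerivAt_iff_isLittleO] at hτ ⊢
  simp only [smul_zero, sub_zero] at hτ ⊢
  refine Asymptotics.IsBigO.trans_isLittleO (Asymptotics.IsBigO.of_bound K ?_) hτ
  exact Eventually.of_forall fun s => by simpa [dist_eq_norm] using hw.dist_le_mul (τ s) (τ t)

theorem arcDensity_nonneg {n : ℕ} {cn T L : ℝ} (hcn : 0 < cn) (hL : 0 ≤ L) {γ : ℝ → ℝ × ℝ}
    (h : IsCurve T γ) (t : ℝ) : 0 ≤ arcDensity n cn T L γ t :=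
  indicator_nonneg (fun s hs => div_nonneg (hspd_nonneg hcn (h.pos s ⟨hs.1.le, hs.2⟩)) hL) t

theorem arcDensity_of_mem {n : ℕ} {cn T L t : ℝ} {γ : ℝ → ℝ × ℝ} (ht : t ∈ Ioo 0 T) :
    arcDensity n cn T L γ t = hspd n cn γ t / L :=
  indicator_of_mem ht _

theorem arcDensity_of_notMem {n : ℕ} {cn T L t : ℝ} {γ : ℝ → ℝ × ℝ} (ht : t ∉ Ioo 0 T) :
    arcDensity n cn T L γ t = 0 :=
  indicator_of_notMem ht _

namespace IsReparam

variable {n : ℕ} {cn T L : ℝ} {γ η : ℝ → ℝ × ℝ} {τ : ℝ → ℝ}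

theorem continuous (r : IsReparam n cn T L γ τ η) : Continuous τ :=
  r.lip.choose_spec.continuous

theorem aemeasurable_ofReal (r : IsReparam n cn T L γ τ η) :
    AEMeasurable fun t => ENNReal.ofReal (arcDensity n cn T L γ t) :=
  r.integrable.aestronglyMeasurable.aemeasurable.ennreal_ofReal

theorem ae_comp (r : IsReparam n cn T L γ τ η) (hcn : 0 < cn) (h : IsCurve T γ) {Q : ℝ → Prop}
    (hQ : ∀ᵐ s, s ∈ Ioo 0 1 → Q s) : ∀ᵐ t, arcDensity n cn T L γ t ≠ 0 → Q (τ t) := by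
  rw [← ae_restrict_iff' measurableSet_Ioo, ← r.map_eq] at hQ
  have := (ae_withDensity_iff' r.aemeasurable_ofReal).1
    (ae_of_ae_map r.continuous.aemeasurable hQ)
  filter_upwards [this] with t ht h0
  refine ht ?_
  simpa using lt_of_le_of_ne (arcDensity_nonneg hcn r.L_pos.le h t) h0.symm

theorem integral_eq (r : IsReparam n cn T L γ τ η) (hcn : 0 < cn) (h : IsCurve T γ) {f : ℝ → ℝ}
    (hf : AEStronglyMeasurable f (volume.restrict (Ioo 0 1))) :
    ∫ s in Ioo (0:ℝ) 1, f s = ∫ t in Ioo 0 T, arcDensity n cn T L γ t * f (τ t) := by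
  rw [← r.map_eq] at hf ⊢
  rw [integral_map r.continuous.aemeasurable hf,
    integral_withDensity_eq_integral_toReal_smul₀ r.aemeasurable_ofReal (by simp),
    ← setIntegral_eq_integral_of_forall_compl_eq_zero (s := Ioo 0 T)]
  · refine integral_congr_ae (Eventually.of_forall fun t => ?_)
    simp only [smul_eq_mul, ENNReal.toReal_ofReal (arcDensity_nonneg hcn r.L_pos.le h t)]
  · intro t ht
    simp [arcDensity_of_notMem ht]

theorem integrableOn (r : IsReparam n cn T L γ τ η) (hcn : 0 < cn) (h : IsCurve T γ) {f : ℝ → ℝ}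
    (hf : IntegrableOn f (Ioo 0 1)) :
    IntegrableOn (fun t => arcDensity n cn T L γ t * f (τ t)) (Ioo 0 T) := by
  rw [IntegrableOn, ← r.map_eq, integrable_map_measure _ r.continuous.aemeasurable,
    integrable_withDensity_iff_integrable_smul₀' r.aemeasurable_ofReal (by simp)] at hf
  · refine (hf.congr (Eventually.of_forall fun t => ?_)).integrableOn
    simp only [smul_eq_mul, ENNReal.toReal_ofReal (arcDensity_nonneg hcn r.L_pos.le h t),
      Function.comp_apply]
  · exact hf.aestronglyMeasurable

theorem ae_hasDerivAt_comp (r : IsReparam n cn T L γ τ η) (hcn : 0 < cn) (h : IsCurve T γ)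
    {w : ℝ → ℝ} {K : NNReal} (hw : LipschitzWith K w) :
    ∀ᵐ t, HasDerivAt (fun s => w (τ s)) (deriv w (τ t) * arcDensity n cn T L γ t) t := by
  filter_upwards [r.ae_hasDerivAt,
    r.ae_comp hcn h (hw.ae_differentiableAt_real.mono fun s hs _ => hs)] with t h1 h2
  by_cases h0 : arcDensity n cn T L γ t = 0
  · rw [h0] at h1 ⊢
    rw [mul_zero]
    exact hw.hasDerivAt_comp_zero h1
  · exact (h2 h0).hasDerivAt.comp t h1

theorem ae_hspd_eq (r : IsReparam n cn T L γ τ η) (hcn : 0 < cn) (h : IsCurve T γ)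
    (hη : IsCurve 1 η) : ∀ᵐ s, s ∈ Ioo 0 1 → hspd n cn η s = L := by
  rw [← ae_restrict_iff' measurableSet_Ioo]
  obtain ⟨f, hf, hfe⟩ := (hη.aestronglyMeasurable_hspd n cn).aemeasurable
  have hpull : ∀ᵐ t, arcDensity n cn T L γ t ≠ 0 → hspd n cn η (τ t) = L := by
    filter_upwards [r.ae_hasDerivAt, r.ae_comp hcn h hη.ae_differentiableAt]
      with t h1 h2 h0
    obtain ⟨hx, hy⟩ := h2 h0
    have ht : t ∈ Ioo 0 T := by
      by_contra hn
      exact h0 (arcDensity_of_notMem hn)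
    have hev : ∀ᶠ s in 𝓝 t, γ s = η (τ s) := by
      filter_upwards [Ioo_mem_nhds ht.1 ht.2] with s hs
      exact (r.eq s ⟨hs.1.le, hs.2⟩).symm
    have e1 : deriv (fun u => (γ u).1) t = _ :=
      (EventuallyEq.deriv_eq (hev.mono fun s hs => congrArg Prod.fst hs)).trans
        (hx.hasDerivAt.comp t h1).deriv
    have e2 : deriv (fun u => (γ u).2) t = _ :=
      (EventuallyEq.deriv_eq (hev.mono fun s hs => congrArg Prod.snd hs)).trans
        (hy.hasDerivAt.comp t h1).deriv
    have hg := arcDensity_nonneg (n := n) hcn r.L_pos.le h t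
    have espd : spd γ t = spd η (τ t) * arcDensity n cn T L γ t := by
      unfold spd
      rw [e1, e2, ← Real.sqrt_sq hg, ← Real.sqrt_mul (by positivity), Real.sqrt_sq hg]
      congr 1
      ring
    have ehspd : hspd n cn γ t = hspd n cn η (τ t) * arcDensity n cn T L γ t := by
      unfold hspd
      rw [espd, r.eq t ⟨ht.1.le, ht.2⟩, mul_assoc]
    have hgL : arcDensity n cn T L γ t * L = hspd n cn γ t := by
      rw [arcDensity_of_mem ht, div_mul_cancel₀ _ r.L_pos.ne']
    refine mul_right_cancel₀ h0 ?_
    rw [← ehspd, ← hgL, mul_comm]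
  have hfL : ∀ᵐ s ∂volume.restrict (Ioo (0:ℝ) 1), f s = L := by
    have hmk : ∀ᵐ t, arcDensity n cn T L γ t ≠ 0 → hspd n cn η (τ t) = f (τ t) :=
      r.ae_comp hcn h ((ae_restrict_iff' measurableSet_Ioo).1 hfe)
    rw [← r.map_eq, ae_map_iff r.continuous.aemeasurable
      (show MeasurableSet {s | f s = L} from hf (measurableSet_singleton L)),
      ae_withDensity_iff' r.aemeasurable_ofReal]
    filter_upwards [hpull, hmk] with t h1 h2 h0
    have : arcDensity n cn T L γ t ≠ 0 := fun h' => h0 (by simp [h'])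
    rw [← h2 this, h1 this]
  filter_upwards [hfe, hfL] with s h1 h2
  rw [h1, h2]

end IsReparam

theorem integrableOn_rpow_deriv_mul {n : ℕ} {cn p B : ℝ} (hcn : 0 < cn) (hp : 0 ≤ p)
    {η : ℝ → ℝ × ℝ} (hη : IsCurve 1 η) (hB : ∀ t ∈ Ico (0:ℝ) 1, Fvol n cn (η t) ≤ B)
    {w : ℝ → ℝ} {K : NNReal} (hw : LipschitzWith K w) :
    IntegrableOn (fun t => |deriv w t| ^ p * Fvol n cn (η t) ^ p) (Ioo 0 1) := by
  refine Integrable.of_bound (AEStronglyMeasurable.mul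
    (((measurable_deriv w).norm).pow_const p).aestronglyMeasurable
    (hη.aestronglyMeasurable_comp (f := fun z => Fvol n cn z ^ p)
      ((continuous_Fvol n cn).rpow_const (fun _ => Or.inr hp)))) ((K:ℝ) ^ p * B ^ p) ?_
  filter_upwards [ae_restrict_mem measurableSet_Ioo] with t ht
  have ht' : t ∈ Ico (0:ℝ) 1 := ⟨ht.1.le, ht.2⟩
  have hF := Fvol_pos (n := n) hcn (hη.pos t ht')
  rw [Real.norm_of_nonneg (by positivity)]
  gcongr
  · exact norm_deriv_le_of_lipschitz hw
  · exact hB t ht'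

theorem IsReparam.weightedBound {n : ℕ} {cn p c L B : ℝ} {γ η : ℝ → ℝ × ℝ} {τ : ℝ → ℝ}
    (r : IsReparam n cn 1 L γ τ η) (hcn : 0 < cn) (hp : 1 < p) (h : IsCurve 1 γ)
    (hη : IsCurve 1 η) (hB : ∀ t ∈ Ico (0:ℝ) 1, Fvol n cn (η t) ≤ B)
    (hb : RayleighBound n cn p γ c) : WeightedBound n cn p η c L := by
  rintro w ⟨K, hK⟩ hw0
  have hL := r.L_pos
  obtain ⟨K', hK'⟩ := r.lip
  have hI := integrableOn_rpow_deriv_mul hcn (by linarith) hη hB hK (p := p)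
  have hnum : rayleighNum n cn p γ (fun t => w (τ t)) =ᵐ[volume.restrict (Ioo 0 1)]
      fun t => L ^ (1 - p) *
        (arcDensity n cn 1 L γ t * (|deriv w (τ t)| ^ p * Fvol n cn (η (τ t)) ^ p)) := by
    filter_upwards [ae_restrict_of_ae (r.ae_hasDerivAt_comp hcn h hK),
      ae_restrict_mem measurableSet_Ioo] with t h1 ht
    have hg := arcDensity_nonneg (n := n) hcn hL.le h t
    have hH : hspd n cn γ t = L * arcDensity n cn 1 L γ t := by
      rw [arcDensity_of_mem ht, mul_div_cancel₀ _ hL.ne']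
    unfold rayleighNum
    rw [h1.deriv, hH, r.eq t ⟨ht.1.le, ht.2⟩, abs_mul, abs_of_nonneg hg,
      Real.mul_rpow (abs_nonneg _) hg, Real.mul_rpow hL.le hg]
    have : arcDensity n cn 1 L γ t ^ p * arcDensity n cn 1 L γ t ^ (1 - p) =
        arcDensity n cn 1 L γ t := by
      rcases hg.eq_or_lt with h0 | h0
      · rw [← h0, Real.zero_rpow (by linarith), zero_mul]
      · rw [← Real.rpow_add h0]; simp
    linear_combination (|deriv w (τ t)| ^ p * Fvol n cn (γ t) ^ p * L ^ (1 - p)) * this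
  have hden : (∫ t in Ioo (0:ℝ) 1, |w (τ t)| ^ p * hspd n cn γ t) =
      L * ∫ t in Ioo (0:ℝ) 1, |w t| ^ p := by
    rw [r.integral_eq hcn h (f := fun s => |w s| ^ p) (hK.continuous.abs.rpow_const
      (fun _ => Or.inr (by linarith))).aestronglyMeasurable, ← integral_const_mul]
    refine setIntegral_congr_fun measurableSet_Ioo fun t ht => ?_
    simp only [arcDensity_of_mem ht]
    field_simp
  have key := hb (fun t => w (τ t)) ⟨K * K', hK.comp hK'⟩ (by simp only [r.zero, hw0])
    (((r.integrableOn hcn h hI).const_mul _).congr hnum.symm)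
  rw [hden, integral_congr_ae hnum, integral_const_mul,
    ← r.integral_eq hcn h hI.aestronglyMeasurable] at key
  have hLp : L ^ (1 - p) * L ^ p = L := by
    rw [← Real.rpow_add hL]; simp
  have hpos : 0 < L ^ (1 - p) := by positivity
  refine le_of_mul_le_mul_left (le_trans (le_of_eq ?_) key) hpos
  linear_combination (c * ∫ t in Ioo (0:ℝ) 1, |w t| ^ p) * hLp

theorem IsReparam.weightedBound_of_le {n : ℕ} {cn p c T L B M : ℝ} {γ η : ℝ → ℝ × ℝ} {τ : ℝ → ℝ}
    (r : IsReparam n cn T L γ τ η) (hcn : 0 < cn) (hp : 1 < p) (hc : 0 ≤ c) (hM : 0 < M)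
    (hT : T ≤ 1) (h : IsCurve T γ) (hγ : ∀ᵐ t, t ∈ Ioo 0 T → hspd n cn γ t ≤ M)
    (hη : IsCurve 1 η) (hB : ∀ t ∈ Ico (0:ℝ) 1, Fvol n cn (η t) ≤ B)
    (hb : ∀ v : ℝ → ℝ, (∃ K, LipschitzWith K v) → v 0 = 0 → (∀ t, T ≤ t → v t = v T) →
      c * M ^ p * ∫ t in Ioo (0:ℝ) 1, |v t| ^ p ≤
        ∫ t in Ioo 0 T, |deriv v t| ^ p * Fvol n cn (γ t) ^ p) :
    WeightedBound n cn p η c L := by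
  rintro w ⟨K, hK⟩ hw0
  have hL := r.L_pos
  obtain ⟨K', hK'⟩ := r.lip
  have hI := integrableOn_rpow_deriv_mul hcn (by linarith) hη hB hK (p := p)
  have hwp : Continuous fun s => |w s| ^ p :=
    hK.continuous.abs.rpow_const (fun _ => Or.inr (by linarith))
  have hwi : IntegrableOn (fun s => |w s| ^ p) (Ioo 0 1) :=
    (hwp.integrableOn_Icc (a := 0) (b := 1)).mono_set Ioo_subset_Icc_self
  have hwτi : IntegrableOn (fun t => |w (τ t)| ^ p) (Ioo 0 1) :=
    ((hwp.comp r.continuous).integrableOn_Icc (a := 0) (b := 1)).mono_set Ioo_subset_Icc_self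
  have hsub : Ioo 0 T ⊆ Ioo (0:ℝ) 1 := Ioo_subset_Ioo_right hT
  have hgM : ∀ᵐ t ∂volume.restrict (Ioo 0 T), arcDensity n cn T L γ t ≤ M / L := by
    rw [ae_restrict_iff' measurableSet_Ioo]
    filter_upwards [hγ] with t h1 ht
    rw [arcDensity_of_mem ht]
    gcongr
    exact h1 ht
  have hnum : (∫ t in Ioo 0 T, |deriv (fun t => w (τ t)) t| ^ p * Fvol n cn (γ t) ^ p) ≤
      (M / L) ^ (p - 1) * ∫ t in Ioo (0:ℝ) 1, |deriv w t| ^ p * Fvol n cn (η t) ^ p := by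
    rw [r.integral_eq hcn h hI.aestronglyMeasurable, ← integral_const_mul]
    refine integral_mono_of_nonneg ?_ ((r.integrableOn hcn h hI).const_mul _) ?_
    · filter_upwards [ae_restrict_mem measurableSet_Ioo] with t ht
      have := Fvol_pos (n := n) hcn (h.pos t ⟨ht.1.le, ht.2⟩)
      show (0:ℝ) ≤ _
      positivity
    · filter_upwards [ae_restrict_of_ae (r.ae_hasDerivAt_comp hcn h hK), hgM,
        ae_restrict_mem measurableSet_Ioo] with t h1 h2 ht
      have hg := arcDensity_nonneg (n := n) hcn hL.le h t
      have hF := Fvol_pos (n := n) hcn (h.pos t ⟨ht.1.le, ht.2⟩)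
      rw [h1.deriv, r.eq t ⟨ht.1.le, ht.2⟩, abs_mul, abs_of_nonneg hg,
        Real.mul_rpow (abs_nonneg _) hg]
      have h3 : arcDensity n cn T L γ t ^ p ≤ (M / L) ^ (p - 1) * arcDensity n cn T L γ t := by
        rcases hg.eq_or_lt with h0 | h0
        · rw [← h0, Real.zero_rpow (by linarith), mul_zero]
        · calc arcDensity n cn T L γ t ^ p
              = arcDensity n cn T L γ t ^ (p - 1) * arcDensity n cn T L γ t := by
                rw [← Real.rpow_add_one h0.ne']; simp
            _ ≤ _ := by gcongr
      calc _ = arcDensity n cn T L γ t ^ p * (|deriv w (τ t)| ^ p * Fvol n cn (γ t) ^ p) := by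
            ring
        _ ≤ (M / L) ^ (p - 1) * arcDensity n cn T L γ t *
            (|deriv w (τ t)| ^ p * Fvol n cn (γ t) ^ p) := by gcongr
        _ = _ := by ring
  have hden : (L / M) * ∫ t in Ioo (0:ℝ) 1, |w t| ^ p ≤ ∫ t in Ioo (0:ℝ) 1, |w (τ t)| ^ p := by
    refine le_trans ?_ (setIntegral_mono_set hwτi (Eventually.of_forall fun t => by positivity)
      hsub.eventuallyLE)
    rw [r.integral_eq hcn h hwp.aestronglyMeasurable, ← integral_const_mul]
    refine integral_mono_ae ((r.integrableOn hcn h hwi).const_mul _) (hwτi.mono_set hsub) ?_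
    filter_upwards [hgM] with t h1
    calc L / M * (arcDensity n cn T L γ t * |w (τ t)| ^ p)
        ≤ L / M * (M / L * |w (τ t)| ^ p) := by gcongr
      _ = |w (τ t)| ^ p := by field_simp
  have key := hb (fun t => w (τ t)) ⟨K * K', hK.comp hK'⟩ (by simp only [r.zero, hw0])
    (fun t ht => by simp only [r.eq_one t ht, r.eq_one T le_rfl])
  have hq : 0 < (M / L) ^ (p - 1) := by positivity
  have hpow : M ^ p * (L / M) = (M / L) ^ (p - 1) * L ^ p := by
    rw [Real.div_rpow hM.le hL.le, Real.rpow_sub_one hM.ne', Real.rpow_sub_one hL.ne']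
    field_simp
  refine le_of_mul_le_mul_left ?_ hq
  calc _ = c * M ^ p * (L / M * ∫ t in Ioo (0:ℝ) 1, |w t| ^ p) := by
        linear_combination (-(c * ∫ t in Ioo (0:ℝ) 1, |w t| ^ p)) * hpow
    _ ≤ c * M ^ p * ∫ t in Ioo (0:ℝ) 1, |w (τ t)| ^ p := by gcongr
    _ ≤ _ := key.trans hnum

/-- A curve of constant `h`-speed `L` in the disc of radius `R` whose Rayleigh quotients are
bounded below by `c`. -/
structure IsNormalized (n : ℕ) (cn p R : ℝ) (z₀ : ℝ × ℝ) (c L : ℝ) (γ : ℝ → ℝ × ℝ) : Prop where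
  init : γ 0 = z₀
  curve : IsBdryCurve n cn 1 L γ
  disc : ∀ t ∈ Ico (0:ℝ) 1, (γ t).1 ^ 2 + (γ t).2 ^ 2 ≤ R ^ 2
  L_pos : 0 < L
  speed : ∀ᵐ t, t ∈ Ioo (0:ℝ) 1 → hspd n cn γ t = L
  weighted : WeightedBound n cn p γ c L

theorem IsReparam.disc {n : ℕ} {cn R T L : ℝ} {γ η : ℝ → ℝ × ℝ} {τ : ℝ → ℝ}
    (r : IsReparam n cn T L γ τ η)
    (hR : ∀ t ∈ Ico 0 T, (γ t).1 ^ 2 + (γ t).2 ^ 2 ≤ R ^ 2) :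
    ∀ t ∈ Ico (0:ℝ) 1, (η t).1 ^ 2 + (η t).2 ^ 2 ≤ R ^ 2 := by
  intro t ht
  obtain ⟨s, hs, rfl⟩ := r.surj t ht
  rw [r.eq s hs]
  exact hR s hs

theorem IsReparam.isNormalized {n : ℕ} {cn p R T c L : ℝ} {γ η : ℝ → ℝ × ℝ} {τ : ℝ → ℝ}
    (r : IsReparam n cn T L γ τ η) (hcn : 0 < cn) (hT : 0 < T) (h : IsCurve T γ)
    (hR : ∀ t ∈ Ico 0 T, (γ t).1 ^ 2 + (γ t).2 ^ 2 ≤ R ^ 2) (hη : IsCurve 1 η)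
    (hlim : Tendsto (fun t => (η t).1 * (η t).2) (𝓝[<] 1) (𝓝 0))
    (hb : WeightedBound n cn p η c L) : IsNormalized n cn p R (γ 0) c L η where
  init := by
    have := r.eq 0 ⟨le_rfl, hT⟩
    rwa [r.zero] at this
  curve := ⟨hη, (r.ae_hspd_eq hcn h hη).mono fun t ht hm => (ht hm).le, hlim⟩
  disc := r.disc hR
  L_pos := r.L_pos
  speed := r.ae_hspd_eq hcn h hη
  weighted := hb

theorem le_one_add_of_disc {R : ℝ} (hR : 0 ≤ R) {z : ℝ × ℝ} (hz : z.1 ^ 2 + z.2 ^ 2 ≤ R ^ 2) :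
    z.1 ≤ 1 + R ∧ z.2 ≤ 1 + R := by
  constructor <;> nlinarith [sq_nonneg z.1, sq_nonneg z.2]

theorem exists_Fvol_le (n : ℕ) {cn R : ℝ} (hcn : 0 < cn) (hR : 0 ≤ R) :
    ∃ B > 0, ∀ z ∈ Pint, z.1 ^ 2 + z.2 ^ 2 ≤ R ^ 2 → Fvol n cn z ≤ B := by
  refine ⟨cn * (1 + R) ^ (n - 1) * (1 + R) ^ (n - 1), by positivity, fun z hz hzR => ?_⟩
  obtain ⟨h1, h2⟩ := le_one_add_of_disc hR hzR
  have := hz.1.le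
  have := hz.2.le
  unfold Fvol
  gcongr

/-- The monomials `x^(n+i) y^(n+j)`. -/
def mono (n i j : ℕ) (z : ℝ × ℝ) : ℝ := z.1 ^ (n + i) * z.2 ^ (n + j)

theorem mono_nonneg (n i j : ℕ) {z : ℝ × ℝ} (hz : z ∈ Pint) : 0 ≤ mono n i j z := by
  have := hz.1.le
  have := hz.2.le
  unfold mono
  positivity

theorem contDiff_mono (n i j : ℕ) : ContDiff ℝ 1 (mono n i j) := by
  unfold mono
  fun_prop

theorem hasFDerivAt_mono (n i j : ℕ) (z : ℝ × ℝ) : HasFDerivAt (mono n i j)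
    (((n + i : ℕ) * z.1 ^ (n + i - 1) * z.2 ^ (n + j)) • ContinuousLinearMap.fst ℝ ℝ ℝ +
      ((n + j : ℕ) * z.1 ^ (n + i) * z.2 ^ (n + j - 1)) • ContinuousLinearMap.snd ℝ ℝ ℝ) z := by
  have h1 := (hasFDerivAt_fst (𝕜 := ℝ) (p := z)).pow (n + i)
  have h2 := (hasFDerivAt_snd (𝕜 := ℝ) (p := z)).pow (n + j)
  refine (h1.mul h2).congr_fderiv ?_
  ext <;> simp <;> ring

theorem mono_gradient_le {n i j : ℕ} (hn : 1 ≤ n) (hij : i + j ≤ 1) {cn R : ℝ} (hcn : 0 < cn)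
    (hR : 0 ≤ R) {z : ℝ × ℝ} (hz : z ∈ Pint) (hzR : z.1 ^ 2 + z.2 ^ 2 ≤ R ^ 2) :
    |((n + i : ℕ) : ℝ) * z.1 ^ (n + i - 1) * z.2 ^ (n + j)| +
      |((n + j : ℕ) : ℝ) * z.1 ^ (n + i) * z.2 ^ (n + j - 1)| ≤
      (2 * n + 1) * (1 + R) ^ 2 / cn * Fvol n cn z := by
  obtain ⟨h1, h2⟩ := le_one_add_of_disc hR hzR
  have hx := hz.1.le
  have hy := hz.2.le
  obtain ⟨m, rfl⟩ : ∃ m, n = m + 1 := ⟨n - 1, by omega⟩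
  rw [abs_of_nonneg (by positivity), abs_of_nonneg (by positivity)]
  have hS : 1 ≤ 1 + R := by linarith
  have key : ∀ a b : ℕ, a + b ≤ 2 → z.1 ^ a * z.2 ^ b ≤ (1 + R) ^ 2 := fun a b hab =>
    calc z.1 ^ a * z.2 ^ b ≤ (1 + R) ^ a * (1 + R) ^ b := by gcongr
      _ = (1 + R) ^ (a + b) := (pow_add _ _ _).symm
      _ ≤ (1 + R) ^ 2 := pow_le_pow_right₀ hS hab
  have k1 := key i (j + 1) (by omega)
  have k2 := key (i + 1) j (by omega)
  have hv : 0 ≤ z.1 ^ m * z.2 ^ m := by positivity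
  have hcast : ((m + 1 + i : ℕ) : ℝ) + ((m + 1 + j : ℕ) : ℝ) ≤ 2 * (m + 1 : ℕ) + 1 := by
    have : (m + 1 + i) + (m + 1 + j) ≤ 2 * (m + 1) + 1 := by omega
    exact_mod_cast this
  have e1 : m + 1 + i - 1 = m + i := by omega
  have e2 : m + 1 + j - 1 = m + j := by omega
  unfold Fvol
  rw [e1, e2]
  calc _ = (z.1 ^ m * z.2 ^ m) * (((m + 1 + i : ℕ) : ℝ) * (z.1 ^ i * z.2 ^ (j + 1)) +
        ((m + 1 + j : ℕ) : ℝ) * (z.1 ^ (i + 1) * z.2 ^ j)) := by ring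
    _ ≤ (z.1 ^ m * z.2 ^ m) * (((m + 1 + i : ℕ) : ℝ) * (1 + R) ^ 2 +
        ((m + 1 + j : ℕ) : ℝ) * (1 + R) ^ 2) := by gcongr
    _ = (z.1 ^ m * z.2 ^ m) * ((((m + 1 + i : ℕ) : ℝ) + ((m + 1 + j : ℕ) : ℝ)) * (1 + R) ^ 2) := by
        ring
    _ ≤ (z.1 ^ m * z.2 ^ m) * ((2 * (m + 1 : ℕ) + 1) * (1 + R) ^ 2) := by gcongr
    _ = _ := by
        rw [Nat.add_sub_cancel]
        field_simp

theorem continuous_mono (n i j : ℕ) : Continuous (mono n i j) := (contDiff_mono n i j).continuous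

section

variable {n i j : ℕ} {cn p R c L : ℝ} {z₀ : ℝ × ℝ} {γ : ℝ → ℝ × ℝ}

theorem IsNormalized.abs_mono_sub_le (h : IsNormalized n cn p R z₀ c L γ) (hn : 1 ≤ n)
    (hij : i + j ≤ 1) (hcn : 0 < cn) (hR : 0 ≤ R) {a b : ℝ} (ha : 0 ≤ a) (hab : a ≤ b)
    (hb : b < 1) : |mono n i j (γ b) - mono n i j (γ a)| ≤
      (2 * n + 1) * (1 + R) ^ 2 / cn * L * (b - a) :=
  h.curve.abs_sub_le (by positivity) h.disc h.curve.bound (contDiff_mono n i j)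
    (hasFDerivAt_mono n i j) (fun _ hz hzR => mono_gradient_le hn hij hcn hR hz hzR) ha hab hb

theorem IsNormalized.tendsto_mono (h : IsNormalized n cn p R z₀ c L γ) (hn : 1 ≤ n)
    (hij : i + j ≤ 1) (hR : 0 ≤ R) : Tendsto (fun t => mono n i j (γ t)) (𝓝[<] 1) (𝓝 0) := by
  have hlim : Tendsto (fun t => ((γ t).1 * (γ t).2) ^ n * (1 + R)) (𝓝[<] 1) (𝓝 0) := by
    have := (h.curve.tendsto.pow n).mul_const (1 + R)
    rwa [zero_pow (by omega), zero_mul] at this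
  refine squeeze_zero' ?_ ?_ hlim <;>
    filter_upwards [Ioo_mem_nhdsLT (zero_lt_one' ℝ)] with t ht
  · exact mono_nonneg n i j (h.curve.pos t ⟨ht.1.le, ht.2⟩)
  · have hz := h.curve.pos t ⟨ht.1.le, ht.2⟩
    obtain ⟨h1, h2⟩ := le_one_add_of_disc hR (h.disc t ⟨ht.1.le, ht.2⟩)
    have hx := hz.1.le
    have hy := hz.2.le
    have : (γ t).1 ^ i * (γ t).2 ^ j ≤ 1 + R :=
      calc (γ t).1 ^ i * (γ t).2 ^ j ≤ (1 + R) ^ i * (1 + R) ^ j := by gcongr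
        _ = (1 + R) ^ (i + j) := (pow_add _ _ _).symm
        _ ≤ (1 + R) ^ 1 := pow_le_pow_right₀ (by linarith) hij
        _ = 1 + R := pow_one _
    calc mono n i j (γ t) = ((γ t).1 * (γ t).2) ^ n * ((γ t).1 ^ i * (γ t).2 ^ j) := by
          unfold mono; ring
      _ ≤ _ := by gcongr

theorem IsNormalized.mono_le (h : IsNormalized n cn p R z₀ c L γ) (hn : 1 ≤ n)
    (hij : i + j ≤ 1) (hcn : 0 < cn) (hR : 0 ≤ R) {a : ℝ} (ha : a ∈ Ico (0:ℝ) 1) :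
    mono n i j (γ a) ≤ (2 * n + 1) * (1 + R) ^ 2 / cn * L * (1 - a) := by
  have hlim : Tendsto (fun b => mono n i j (γ b) +
      (2 * n + 1) * (1 + R) ^ 2 / cn * L * (b - a)) (𝓝[<] 1)
      (𝓝 (0 + (2 * n + 1) * (1 + R) ^ 2 / cn * L * (1 - a))) := by
    refine (h.tendsto_mono hn hij hR).add ?_
    have : Continuous fun b : ℝ => (2 * n + 1) * (1 + R) ^ 2 / cn * L * (b - a) := by fun_prop
    exact (this.tendsto 1).mono_left nhdsWithin_le_nhds
  rw [zero_add] at hlim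
  refine ge_of_tendsto hlim ?_
  filter_upwards [Ioo_mem_nhdsLT ha.2] with b hb
  have := h.abs_mono_sub_le hn hij hcn hR ha.1 hb.1.le hb.2
  linarith [neg_abs_le (mono n i j (γ b) - mono n i j (γ a))]

/-- The monomials along the curve, extended by zero, form a Lipschitz function. -/
theorem IsNormalized.lipschitzOnWith_mono (h : IsNormalized n cn p R z₀ c L γ) (hn : 1 ≤ n)
    (hij : i + j ≤ 1) (hcn : 0 < cn) (hR : 0 ≤ R) :
    LipschitzOnWith (Real.toNNReal ((2 * n + 1) * (1 + R) ^ 2 / cn * L))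
      (fun t => if t < 1 then mono n i j (γ t) else 0) (Icc 0 1) := by
  have hL := h.L_pos
  have key : ∀ s t, 0 ≤ s → s ≤ t → t ≤ 1 →
      dist (if t < 1 then mono n i j (γ t) else 0) (if s < 1 then mono n i j (γ s) else 0) ≤
        (2 * n + 1) * (1 + R) ^ 2 / cn * L * dist t s := by
    intro s t hs hst ht
    rw [Real.dist_eq, Real.dist_eq, abs_of_nonneg (sub_nonneg.2 hst)]
    by_cases ht1 : t < 1
    · rw [if_pos ht1, if_pos (hst.trans_lt ht1)]
      exact h.abs_mono_sub_le hn hij hcn hR hs hst ht1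
    · obtain rfl : t = 1 := le_antisymm ht (not_lt.1 ht1)
      rw [if_neg ht1, zero_sub, abs_neg]
      split_ifs with hs1
      · rw [abs_of_nonneg (mono_nonneg n i j (h.curve.pos s ⟨hs, hs1⟩))]
        exact h.mono_le hn hij hcn hR ⟨hs, hs1⟩
      · rw [abs_zero]
        have : 0 ≤ 1 - s := by linarith
        positivity
  refine LipschitzOnWith.of_dist_le_mul fun s hs t ht => ?_
  rw [Real.coe_toNNReal _ (by positivity)]
  rcases le_total s t with hst | hst
  · rw [dist_comm, dist_comm s]
    exact key s t hs.1 hst ht.2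
  · exact key t s ht.1 hst hs.2

end

/-- Arzelà–Ascoli for uniformly Lipschitz functions on the unit interval. -/
theorem exists_subseq_tendsto_of_lipschitz {E : Type*} [PseudoMetricSpace E] [ProperSpace E]
    [T2Space E] {K : NNReal} {f : ℕ → ℝ → E} (hf : ∀ k, LipschitzOnWith K (f k) (Icc 0 1))
    (z : E) (hz : ∀ k, f k 1 = z) :
    ∃ (σ : ℕ → ℕ) (g : ℝ → E), StrictMono σ ∧ LipschitzOnWith K g (Icc 0 1) ∧
      ∀ t ∈ Icc (0:ℝ) 1, Tendsto (fun k => f (σ k) t) atTop (𝓝 (g t)) := by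
  have hL : ∀ k, LipschitzWith K ((Icc (0:ℝ) 1).domRestrict (f k)) := fun k =>
    lipschitzOnWith_iff_restrict.1 (hf k)
  set F : ℕ → BoundedContinuousFunction (Icc (0:ℝ) 1) E := fun k =>
    BoundedContinuousFunction.mkOfCompact ⟨_, (hL k).continuous⟩ with hF
  have hcomp : IsCompact (closure (range F)) := by
    refine BoundedContinuousFunction.arzela_ascoli (Metric.closedBall z K)
      (isCompact_closedBall z K) (range F) ?_ ?_
    · rintro _ ⟨t, ht⟩ ⟨k, rfl⟩
      rw [Metric.mem_closedBall]
      have := (hf k).dist_le_mul t ht 1 ⟨zero_le_one, le_rfl⟩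
      rw [hz] at this
      refine this.trans (mul_le_of_le_one_right K.2 ?_)
      rw [Real.dist_eq, abs_le]
      constructor <;> linarith [ht.1, ht.2]
    · refine (LipschitzWith.uniformEquicontinuous _ K ?_).equicontinuous
      rintro ⟨_, k, rfl⟩
      exact hL k
  obtain ⟨G, -, σ, hσ, hlim⟩ := hcomp.tendsto_subseq (x := F) fun k => subset_closure ⟨k, rfl⟩
  have hpt : ∀ t : Icc (0:ℝ) 1, Tendsto (fun k => f (σ k) t) atTop (𝓝 (G t)) := fun t =>
    (BoundedContinuousFunction.tendsto_iff_tendstoUniformly.1 hlim).tendsto_at t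
  refine ⟨σ, IccExtend zero_le_one G, hσ, ?_, fun t ht => ?_⟩
  · refine LipschitzOnWith.of_dist_le_mul fun s hs t ht => ?_
    rw [IccExtend_of_mem _ _ hs, IccExtend_of_mem _ _ ht]
    exact le_of_tendsto ((hpt ⟨s, hs⟩).dist (hpt ⟨t, ht⟩))
      (Eventually.of_forall fun k => (hf (σ k)).dist_le_mul s hs t ht)
  · rw [IccExtend_of_mem _ _ ht]
    exact hpt ⟨t, ht⟩

section

variable {n : ℕ} {cn p R : ℝ} {z₀ : ℝ × ℝ}

theorem exists_pos_le_length (hn : 1 ≤ n) (hcn : 0 < cn) (hR : 0 ≤ R) (hz₀ : z₀ ∈ Pint) :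
    ∃ l > 0, ∀ c L γ, IsNormalized n cn p R z₀ c L γ → l ≤ L := by
  have hC : 0 < (2 * n + 1) * (1 + R) ^ 2 / cn := by positivity
  refine ⟨mono n 0 0 z₀ / ((2 * n + 1) * (1 + R) ^ 2 / cn), ?_, fun c L γ h => ?_⟩
  · have := hz₀.1
    have := hz₀.2
    unfold mono
    positivity
  · have := h.mono_le hn (i := 0) (j := 0) (by norm_num) hcn hR ⟨le_rfl, zero_lt_one⟩
    rw [h.init] at this
    rw [div_le_iff₀ hC]
    linarith

/-- Testing with the identity bounds `c L^p`. -/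
theorem exists_mul_rpow_le (hcn : 0 < cn) (hp : 0 ≤ p) (hR : 0 ≤ R) :
    ∃ D > 0, ∀ c L γ, IsNormalized n cn p R z₀ c L γ → c * L ^ p ≤ D := by
  obtain ⟨B, hB0, hB⟩ := exists_Fvol_le n hcn hR
  have hJ : 0 < ∫ t in Ioo (0:ℝ) 1, |t| ^ p := by
    have : Continuous fun t : ℝ => |t| ^ p := continuous_abs.rpow_const (fun _ => Or.inr hp)
    rw [← integral_Ioc_eq_integral_Ioo, ← intervalIntegral.integral_of_le zero_le_one]
    refine intervalIntegral.intervalIntegral_pos_of_pos_on (this.intervalIntegrable _ _) ?_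
      zero_lt_one
    intro t ht
    have : 0 < |t| := abs_pos.2 ht.1.ne'
    positivity
  refine ⟨B ^ p / ∫ t in Ioo (0:ℝ) 1, |t| ^ p, by positivity, fun c L γ h => ?_⟩
  have hBγ : ∀ t ∈ Ico (0:ℝ) 1, Fvol n cn (γ t) ≤ B := fun t ht =>
    hB _ (h.curve.pos t ht) (h.disc t ht)
  have key := h.weighted (fun t => t) ⟨1, LipschitzWith.id⟩ rfl
  rw [le_div_iff₀ hJ]
  refine key.trans ?_
  calc _ ≤ ∫ t in Ioo (0:ℝ) 1, B ^ p := by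
        refine setIntegral_mono_on (integrableOn_rpow_deriv_mul hcn hp h.curve.toIsCurve hBγ
          LipschitzWith.id) (integrable_const _) measurableSet_Ioo fun t ht => ?_
        have hF := Fvol_pos (n := n) hcn (h.curve.pos t ⟨ht.1.le, ht.2⟩)
        simp only [deriv_id'', abs_one, Real.one_rpow, one_mul]
        gcongr
        exact hBγ t ⟨ht.1.le, ht.2⟩
    _ = B ^ p := by simp

theorem exists_length_le (hcn : 0 < cn) (hp : 0 < p) (hR : 0 ≤ R) {c₀ : ℝ} (hc₀ : 0 < c₀) :
    ∃ l, ∀ c L γ, c₀ ≤ c → IsNormalized n cn p R z₀ c L γ → L ≤ l := by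
  obtain ⟨D, hD, h⟩ := exists_mul_rpow_le (n := n) (z₀ := z₀) hcn hp.le hR
  refine ⟨(D / c₀) ^ p⁻¹, fun c L γ hc hγ => ?_⟩
  have hL := hγ.L_pos
  rw [Real.le_rpow_inv_iff_of_pos hL.le (by positivity) hp, le_div_iff₀ hc₀, mul_comm]
  exact (mul_le_mul_of_nonneg_right hc (by positivity)).trans (h c L γ hγ)

theorem exists_bound_le (hn : 1 ≤ n) (hcn : 0 < cn) (hp : 0 < p) (hR : 0 ≤ R) (hz₀ : z₀ ∈ Pint) :
    ∃ C, ∀ c L γ, IsNormalized n cn p R z₀ c L γ → c ≤ C := by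
  obtain ⟨D, hD, h⟩ := exists_mul_rpow_le (n := n) (z₀ := z₀) hcn hp.le hR
  obtain ⟨l, hl, hlen⟩ := exists_pos_le_length (p := p) hn hcn hR hz₀
  refine ⟨D / l ^ p, fun c L γ hγ => ?_⟩
  have hL := hlen c L γ hγ
  have hLp : l ^ p ≤ L ^ p := by gcongr
  have hlp : 0 < l ^ p := by positivity
  rcases le_total c 0 with hc | hc
  · exact hc.trans (by positivity)
  · rw [le_div_iff₀ hlp]
    exact (mul_le_mul_of_nonneg_left hLp hc).trans (h c L γ hγ)

end

theorem LipschitzOnWith.exists_div {f g : ℝ → ℝ} {a m : ℝ} {K : NNReal}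
    (hf : LipschitzOnWith K f (Icc 0 a)) (hg : LipschitzOnWith K g (Icc 0 a)) (hm : 0 < m)
    (hgm : ∀ t ∈ Icc 0 a, m ≤ g t) : ∃ K', LipschitzOnWith K' (fun t => f t / g t) (Icc 0 a) := by
  obtain ⟨A, hA⟩ := isCompact_Icc.exists_bound_of_continuousOn hf.continuousOn
  obtain ⟨B, hB⟩ := isCompact_Icc.exists_bound_of_continuousOn hg.continuousOn
  have key : ∀ s ∈ Icc 0 a, ∀ t ∈ Icc 0 a,
      dist (f s / g s) (f t / g t) ≤ K * (|A| + |B|) / m ^ 2 * dist s t := by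
    intro s hs t ht
    have hs0 := hm.trans_le (hgm s hs)
    have ht0 := hm.trans_le (hgm t ht)
    have h1 := hf.dist_le_mul s hs t ht
    have h2 := hg.dist_le_mul s hs t ht
    have hAt : |f t| ≤ |A| := (hA t ht).trans (le_abs_self A)
    have hBt : |g t| ≤ |B| := (hB t ht).trans (le_abs_self B)
    rw [Real.dist_eq] at h1 h2 ⊢
    have e : f s / g s - f t / g t =
        ((f s - f t) * g t - f t * (g s - g t)) / (g s * g t) := by
      field_simp
      ring
    rw [e, abs_div, abs_of_pos (mul_pos hs0 ht0), div_le_iff₀ (mul_pos hs0 ht0)]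
    have hmm : m ^ 2 ≤ g s * g t := by
      rw [sq]
      exact mul_le_mul (hgm s hs) (hgm t ht) hm.le hs0.le
    calc |(f s - f t) * g t - f t * (g s - g t)|
        ≤ |f s - f t| * |g t| + |f t| * |g s - g t| := by
          rw [← abs_mul, ← abs_mul]
          exact abs_sub _ _
      _ ≤ (K * dist s t) * |B| + |A| * (K * dist s t) := by gcongr
      _ = K * (|A| + |B|) / m ^ 2 * dist s t * m ^ 2 := by
          field_simp
          ring
      _ ≤ _ := by gcongr
  exact ⟨_, LipschitzOnWith.of_dist_le' key⟩

theorem exists_first_zero {ψ : ℝ → ℝ} (hψ : ContinuousOn ψ (Icc 0 1))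
    (hnn : ∀ t ∈ Icc (0:ℝ) 1, 0 ≤ ψ t) (h0 : 0 < ψ 0) (h1 : ψ 1 = 0) :
    ∃ T ∈ Ioc (0:ℝ) 1, ψ T = 0 ∧ ∀ t ∈ Ico 0 T, 0 < ψ t := by
  have hc : IsCompact (Icc (0:ℝ) 1 ∩ ψ ⁻¹' {0}) :=
    isCompact_Icc.of_isClosed_subset
      (hψ.preimage_isClosed_of_isClosed isClosed_Icc isClosed_singleton) inter_subset_left
  obtain ⟨T, ⟨hT, hT0⟩, hmin⟩ := hc.exists_isLeast ⟨1, ⟨zero_le_one, le_rfl⟩, h1⟩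
  refine ⟨T, ⟨lt_of_le_of_ne hT.1 ?_, hT.2⟩, hT0, fun t ht => ?_⟩
  · rintro rfl
    exact h0.ne' hT0
  · have ht1 : t ∈ Icc (0:ℝ) 1 := ⟨ht.1, ht.2.le.trans hT.2⟩
    refine lt_of_le_of_ne (hnn t ht1) fun h => ?_
    exact absurd (hmin ⟨ht1, h.symm⟩) (not_le.2 ht.2)

theorem Fvol_pow {n : ℕ} {cn : ℝ} (z : ℝ × ℝ) :
    Fvol n cn z ^ n = cn ^ n * mono n 0 0 z ^ (n - 1) := by
  unfold Fvol mono
  simp only [add_zero, mul_pow, ← pow_mul]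
  rw [mul_comm n (n - 1), mul_assoc]

section

variable {n : ℕ} {cn p R Λ M T : ℝ} {z₀ : ℝ × ℝ} {c L : ℕ → ℝ} {γ : ℕ → ℝ → ℝ × ℝ}
  {γ₀ : ℝ → ℝ × ℝ}

theorem abs_linear_sub_le {γ : ℝ → ℝ × ℝ} (h : IsCurve 1 γ)
    (hγ : ∀ᵐ t, t ∈ Ioo 0 1 → hspd n cn γ t ≤ M) {t u f : ℝ} (ht : 0 ≤ t) (htu : t ≤ u)
    (hu : u < 1) (hf : 0 < f) (hF : ∀ s ∈ Icc t u, f ≤ Fvol n cn (γ s)) (a b : ℝ) :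
    |(a * (γ u).1 + b * (γ u).2) - (a * (γ t).1 + b * (γ t).2)| ≤
      Real.sqrt (a ^ 2 + b ^ 2) * (M / f) * (u - t) := by
  obtain ⟨K, hK⟩ := h.lip u ⟨ht.trans htu, hu⟩
  have hlip : LipschitzOnWith _ (fun s => a * (γ s).1 + b * (γ s).2) (Icc t u) :=
    (((lipschitzWith_smul a).comp LipschitzWith.prod_fst).add
      ((lipschitzWith_smul b).comp LipschitzWith.prod_snd)).comp_lipschitzOnWith
      (hK.mono (Icc_subset_Icc_left ht))
  have := abs_sub_le_integral_of_abs_deriv_le htu hlip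
    (g := fun _ => Real.sqrt (a ^ 2 + b ^ 2) * (M / f)) ?_ (by simp)
  · rwa [intervalIntegral.integral_const, smul_eq_mul, mul_comm (u - t)] at this
  · filter_upwards [hγ, h.ae_differentiableAt] with s hs hd hsu
    have hs1 : s ∈ Ioo (0:ℝ) 1 := ⟨ht.trans_lt hsu.1, hsu.2.trans hu⟩
    obtain ⟨d1, d2⟩ := hd hs1
    have hder := ((d1.hasDerivAt.const_mul a).add (d2.hasDerivAt.const_mul b)).deriv
    have hspd : spd γ s ≤ M / f := by
      rw [le_div_iff₀ hf, mul_comm]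
      exact (mul_le_mul_of_nonneg_right (hF s ⟨hsu.1.le, hsu.2.le⟩) (spd_nonneg _ _)).trans (hs hs1)
    calc _ = |a * deriv (fun u => (γ u).1) s + b * deriv (fun u => (γ u).2) s| := by
            rw [← hder]; rfl
      _ ≤ Real.sqrt (a ^ 2 + b ^ 2) * spd γ s := by
          rw [spd, ← Real.sqrt_mul (by positivity)]
          refine Real.abs_le_sqrt ?_
          nlinarith [sq_nonneg (a * deriv (fun u => (γ u).2) s - b * deriv (fun u => (γ u).1) s)]
      _ ≤ _ := by gcongr

/-- The `h`-speed is lower semicontinuous under pointwise convergence. -/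
theorem hspd_le_of_tendsto {K : NNReal} (hn : 1 ≤ n) (hcn : 0 < cn)
    (hγ : ∀ k, IsNormalized n cn p R z₀ (c k) (L k) (γ k)) (hL : Tendsto L atTop (𝓝 M))
    (hK : ∀ k, LipschitzOnWith K (fun t => if t < 1 then mono n 0 0 (γ k t) else 0) (Icc 0 1))
    (hT : T ≤ 1) (h₀ : IsCurve T γ₀)
    (hlim : ∀ t ∈ Ico 0 T, Tendsto (fun k => γ k t) atTop (𝓝 (γ₀ t))) {t : ℝ} (ht : t ∈ Ioo 0 T)
    (d1 : DifferentiableAt ℝ (fun u => (γ₀ u).1) t)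
    (d2 : DifferentiableAt ℝ (fun u => (γ₀ u).2) t) : hspd n cn γ₀ t ≤ M := by
  have hM : 0 ≤ M := ge_of_tendsto' hL fun k => (hγ k).L_pos.le
  have htT : t ∈ Ico 0 T := ⟨ht.1.le, ht.2⟩
  have hF₀ := Fvol_pos hcn (h₀.pos t htT) (n := n)
  have main : ∀ f, 0 < f → f < Fvol n cn (γ₀ t) → f * spd γ₀ t ≤ M := by
    intro f hf hfF
    have hΦ : Continuous fun m : ℝ => cn ^ n * m ^ (n - 1) := by fun_prop
    have hlt : f ^ n < cn ^ n * mono n 0 0 (γ₀ t) ^ (n - 1) := by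
      rw [← Fvol_pow]
      exact pow_lt_pow_left₀ hfF hf.le (by omega)
    obtain ⟨ε, hε, hball⟩ := Metric.eventually_nhds_iff.1
      (hΦ.continuousAt.eventually (lt_mem_nhds hlt))
    set δ : ℝ := ε / (2 * (K + 1)) with hδ
    have hδ0 : 0 < δ := by positivity
    have hδK : K * δ < ε / 2 := by
      rw [hδ, mul_div_assoc', div_lt_div_iff₀ (by positivity) (by positivity)]
      nlinarith [K.2]
    have hev : ∀ᶠ k in atTop, dist (mono n 0 0 (γ k t)) (mono n 0 0 (γ₀ t)) < ε / 2 :=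
      (((continuous_mono n 0 0).tendsto _).comp (hlim t htT)).eventually
        (Metric.ball_mem_nhds _ (by positivity))
    have hFk : ∀ᶠ k in atTop, ∀ s ∈ Icc t (t + δ), s < 1 → f ≤ Fvol n cn (γ k s) := by
      filter_upwards [hev] with k hk s hs hs1
      have hs0 : 0 ≤ s := ht.1.le.trans hs.1
      have h1 := (hK k).dist_le_mul s ⟨hs0, hs1.le⟩ t ⟨ht.1.le, ht.2.le.trans hT⟩
      simp only [if_pos hs1, if_pos (ht.2.trans_le hT)] at h1
      have h2 : (K : ℝ) * dist s t ≤ K * δ := by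
        refine mul_le_mul_of_nonneg_left ?_ K.2
        rw [Real.dist_eq, abs_of_nonneg (by linarith [hs.1])]
        linarith [hs.2]
      have h3 := hball ((dist_triangle _ _ _).trans_lt (by linarith :
        dist (mono n 0 0 (γ k s)) (mono n 0 0 (γ k t)) +
          dist (mono n 0 0 (γ k t)) (mono n 0 0 (γ₀ t)) < ε))
      rw [← Fvol_pow] at h3
      exact (lt_of_pow_lt_pow_left₀ n (Fvol_pos hcn ((hγ k).curve.pos s ⟨hs0, hs1⟩)).le h3).le
    set a := deriv (fun u => (γ₀ u).1) t with ha
    set b := deriv (fun u => (γ₀ u).2) t with hb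
    have hS : Real.sqrt (a ^ 2 + b ^ 2) = spd γ₀ t := rfl
    have hS2 : spd γ₀ t * spd γ₀ t = a * a + b * b := by
      rw [← hS, Real.mul_self_sqrt (by positivity)]
      ring
    have hslope : ∀ u, t < u → u ≤ t + δ → u < T →
        |(a * (γ₀ u).1 + b * (γ₀ u).2) - (a * (γ₀ t).1 + b * (γ₀ t).2)| ≤
          spd γ₀ t * (M / f) * (u - t) := by
      intro u htu huδ huT
      have hu : u ∈ Ico 0 T := ⟨ht.1.le.trans htu.le, huT⟩
      have hφ : Continuous fun z : ℝ × ℝ => a * z.1 + b * z.2 := by fun_prop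
      refine le_of_tendsto_of_tendsto
        ((((hφ.tendsto _).comp (hlim u hu)).sub ((hφ.tendsto _).comp (hlim t htT))).abs)
        (((hL.div_const f).const_mul (spd γ₀ t)).mul_const (u - t)) ?_
      filter_upwards [hFk] with k hk
      exact abs_linear_sub_le (hγ k).curve.toIsCurve (hγ k).curve.bound ht.1.le htu.le
        (huT.trans_le hT) hf
        (fun s hs => hk s ⟨hs.1, hs.2.trans huδ⟩ (hs.2.trans_lt (huT.trans_le hT))) a b
    have hder : HasDerivAt (fun u => a * (γ₀ u).1 + b * (γ₀ u).2) (a * a + b * b) t :=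
      (d1.hasDerivAt.const_mul a).add (d2.hasDerivAt.const_mul b)
    have hle : a * a + b * b ≤ spd γ₀ t * (M / f) := by
      have hw := (hasDerivWithinAt_iff_tendsto_slope' (s := Ioi t) (by simp)).1
        hder.hasDerivWithinAt
      refine le_of_tendsto hw ?_
      filter_upwards [Ioo_mem_nhdsGT (lt_min (lt_add_of_pos_right t hδ0) ht.2)] with u hu
      rw [slope_def_field, div_le_iff₀ (sub_pos.2 hu.1)]
      exact (le_abs_self _).trans (hslope u hu.1 (hu.2.le.trans (min_le_left _ _))
        (hu.2.trans_le (min_le_right _ _)))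
    rw [← hS2] at hle
    rcases (spd_nonneg γ₀ t).eq_or_lt with h0 | h0
    · rw [← h0, mul_zero]
      exact hM
    · rw [mul_comm, ← le_div_iff₀ hf]
      exact le_of_mul_le_mul_left hle h0
  have hc : Tendsto (fun f => f * spd γ₀ t) (𝓝[<] Fvol n cn (γ₀ t)) (𝓝 (hspd n cn γ₀ t)) :=
    ((continuous_mul_const (spd γ₀ t)).tendsto _).mono_left nhdsWithin_le_nhds
  refine le_of_tendsto hc ?_
  filter_upwards [Ioo_mem_nhdsLT hF₀] with f hf
  exact main f hf.1 hf.2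

/-- Passage to the limit in the weighted inequality for test functions that are constant
beyond `T`. -/
theorem integral_le_of_tendsto (hcn : 0 < cn) (hp : 0 < p) (hR : 0 ≤ R)
    (hγ : ∀ k, IsNormalized n cn p R z₀ (c k) (L k) (γ k)) (hL : Tendsto L atTop (𝓝 M))
    (hc : Tendsto c atTop (𝓝 Λ)) (hM : 0 < M) (hT : T ≤ 1)
    (hlim : ∀ t ∈ Ico 0 T, Tendsto (fun k => γ k t) atTop (𝓝 (γ₀ t)))
    {v : ℝ → ℝ} {K : NNReal} (hv : LipschitzWith K v) (hv0 : v 0 = 0)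
    (hvT : ∀ t, T ≤ t → v t = v T) :
    Λ * M ^ p * ∫ t in Ioo (0:ℝ) 1, |v t| ^ p ≤
      ∫ t in Ioo 0 T, |deriv v t| ^ p * Fvol n cn (γ₀ t) ^ p := by
  obtain ⟨B, hB0, hB⟩ := exists_Fvol_le n hcn hR
  have hleft : Tendsto (fun k => c k * L k ^ p * ∫ t in Ioo (0:ℝ) 1, |v t| ^ p) atTop
      (𝓝 (Λ * M ^ p * ∫ t in Ioo (0:ℝ) 1, |v t| ^ p)) :=
    (hc.mul (hL.rpow_const (Or.inl hM.ne'))).mul_const _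
  have hsub : Ioo 0 T ⊆ Ioo (0:ℝ) 1 := Ioo_subset_Ioo_right hT
  have hright : Tendsto
      (fun k => ∫ t in Ioo (0:ℝ) 1, |deriv v t| ^ p * Fvol n cn (γ k t) ^ p) atTop
      (𝓝 (∫ t in Ioo (0:ℝ) 1,
        indicator (Ioo 0 T) (fun t => |deriv v t| ^ p * Fvol n cn (γ₀ t) ^ p) t)) := by
    refine tendsto_integral_of_dominated_convergence (fun _ => (K : ℝ) ^ p * B ^ p)
      (fun k => ?_) (integrable_const _) (fun k => ?_) ?_
    · have h1 : AEMeasurable (fun t => Fvol n cn (γ k t)) (volume.restrict (Ioo 0 1)) :=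
        ((hγ k).curve.aestronglyMeasurable_comp (continuous_Fvol n cn)).aemeasurable
      have h2 : Measurable fun t => |deriv v t| := (measurable_deriv v).norm
      exact ((h2.pow_const p).aemeasurable.mul (h1.pow_const p)).aestronglyMeasurable
    · refine (ae_restrict_iff' measurableSet_Ioo).2 (Eventually.of_forall fun t ht => ?_)
      have ht' : t ∈ Ico (0:ℝ) 1 := ⟨ht.1.le, ht.2⟩
      have hpos := (hγ k).curve.pos t ht'
      have hF := (Fvol_pos hcn hpos (n := n)).le
      have hFB := hB _ hpos ((hγ k).disc t ht')
      have hd : |deriv v t| ≤ K := norm_deriv_le_of_lipschitz hv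
      rw [Real.norm_of_nonneg (by positivity)]
      gcongr
    · have hne : ∀ᵐ t : ℝ, t ≠ T := by simp [ae_iff]
      refine (ae_restrict_iff' measurableSet_Ioo).2 ?_
      filter_upwards [hne] with t htT ht
      by_cases htm : t ∈ Ioo 0 T
      · rw [indicator_of_mem htm]
        exact ((((continuous_Fvol n cn).tendsto _).comp
          (hlim t ⟨htm.1.le, htm.2⟩)).rpow_const (Or.inr hp.le)).const_mul _
      · have hTt : T < t := lt_of_le_of_ne (not_lt.1 fun h => htm ⟨ht.1, h⟩) htT.symm
        have hd : deriv v t = 0 := by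
          have : v =ᶠ[𝓝 t] fun _ => v T := by
            filter_upwards [Ioi_mem_nhds hTt] with s hs
            exact hvT s (le_of_lt hs)
          rw [this.deriv_eq, deriv_const]
        simp [indicator_of_notMem htm, hd, Real.zero_rpow hp.ne']
  rw [setIntegral_indicator measurableSet_Ioo, inter_eq_right.2 hsub] at hright
  exact le_of_tendsto_of_tendsto' hleft hright fun k => (hγ k).weighted v ⟨K, hv⟩ hv0

/-- Normalized curves with bounded lengths subconverge, together with the coordinates of the
map `(x, y) ↦ x^n y^n (1, x, y)`. -/
theorem exists_subseq_mono {l : ℝ} (hn : 1 ≤ n) (hcn : 0 < cn) (hR : 0 ≤ R)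
    (hγ : ∀ k, IsNormalized n cn p R z₀ (c k) (L k) (γ k)) (hl : ∀ k, L k ≤ l) :
    ∃ (σ : ℕ → ℕ) (K : NNReal) (ψ f g : ℝ → ℝ), StrictMono σ ∧
      (∀ k, LipschitzOnWith K (fun t => if t < 1 then mono n 0 0 (γ k t) else 0) (Icc 0 1)) ∧
      LipschitzOnWith K ψ (Icc 0 1) ∧ LipschitzOnWith K f (Icc 0 1) ∧
      LipschitzOnWith K g (Icc 0 1) ∧ ψ 1 = 0 ∧ ∀ t ∈ Ico (0:ℝ) 1,
        Tendsto (fun k => mono n 0 0 (γ (σ k) t)) atTop (𝓝 (ψ t)) ∧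
        Tendsto (fun k => mono n 1 0 (γ (σ k) t)) atTop (𝓝 (f t)) ∧
        Tendsto (fun k => mono n 0 1 (γ (σ k) t)) atTop (𝓝 (g t)) := by
  set K := Real.toNNReal ((2 * n + 1) * (1 + R) ^ 2 / cn * l) with hKdef
  have hK : ∀ i j, i + j ≤ 1 → ∀ k, LipschitzOnWith K
      (fun t => if t < 1 then mono n i j (γ k t) else 0) (Icc 0 1) := fun i j hij k =>
    ((hγ k).lipschitzOnWith_mono hn hij hcn hR).weaken
      (Real.toNNReal_le_toNNReal (mul_le_mul_of_nonneg_left (hl k) (by positivity)))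
  obtain ⟨σ₁, ψ, hσ₁, hψ, hψlim⟩ := exists_subseq_tendsto_of_lipschitz
    (hK 0 0 (by norm_num)) 0 (fun k => by simp)
  obtain ⟨σ₂, f, hσ₂, hf, hflim⟩ := exists_subseq_tendsto_of_lipschitz
    (fun k => hK 1 0 (by norm_num) (σ₁ k)) 0 (fun k => by simp)
  obtain ⟨σ₃, g, hσ₃, hg, hglim⟩ := exists_subseq_tendsto_of_lipschitz
    (fun k => hK 0 1 (by norm_num) (σ₁ (σ₂ k))) 0 (fun k => by simp)
  refine ⟨fun k => σ₁ (σ₂ (σ₃ k)), K, ψ, f, g, hσ₁.comp (hσ₂.comp hσ₃), hK 0 0 (by norm_num),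
    hψ, hf, hg, ?_, fun t ht => ?_⟩
  · have := hψlim 1 ⟨zero_le_one, le_rfl⟩
    simp only [lt_irrefl, if_false] at this
    exact tendsto_nhds_unique this tendsto_const_nhds
  · have ht' : t ∈ Icc (0:ℝ) 1 := ⟨ht.1, ht.2.le⟩
    have h1 := (hψlim t ht').comp (hσ₂.comp hσ₃).tendsto_atTop
    have h2 := (hflim t ht').comp hσ₃.tendsto_atTop
    have h3 := hglim t ht'
    simp only [if_pos ht.2] at h1 h2 h3
    exact ⟨h1, h2, h3⟩

/-- Closure of the class of normalized curves: along a sequence of normalized curves, the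
constants in the weighted inequalities pass to the limit. -/
theorem exists_isNormalized_of_tendsto {l : ℝ} (hn : 1 ≤ n) (hcn : 0 < cn) (hR : 0 ≤ R)
    (hp : 1 < p) (hz₀ : z₀ ∈ Pint) (hγ : ∀ k, IsNormalized n cn p R z₀ (c k) (L k) (γ k))
    (hl : ∀ k, L k ≤ l) (hΛ : 0 ≤ Λ) (hc : Tendsto c atTop (𝓝 Λ)) :
    ∃ L' η, IsNormalized n cn p R z₀ Λ L' η := by
  obtain ⟨l₀, hl₀, hlow⟩ := exists_pos_le_length (p := p) hn hcn hR hz₀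
  obtain ⟨M, hM, ρ, hρ, hLM⟩ := isCompact_Icc.tendsto_subseq
    (x := L) fun k => ⟨hlow _ _ _ (hγ k), hl k⟩
  have hM0 : 0 < M := hl₀.trans_le hM.1
  obtain ⟨σ, K, ψ, f, g, hσ, hK, hψ, hf, hg, hψ1, hlim⟩ :=
    exists_subseq_mono hn hcn hR (fun k => hγ (ρ k)) (fun k => hl (ρ k))
  have hψnn : ∀ t ∈ Icc (0:ℝ) 1, 0 ≤ ψ t := by
    intro t ht
    rcases ht.2.lt_or_eq with h | rfl
    · exact ge_of_tendsto' (hlim t ⟨ht.1, h⟩).1 fun k =>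
        mono_nonneg n 0 0 ((hγ _).curve.pos t ⟨ht.1, h⟩)
    · exact hψ1.ge
  have hψ0 : 0 < ψ 0 := by
    have := (hlim 0 ⟨le_rfl, zero_lt_one⟩).1
    simp only [(hγ _).init] at this
    rw [← tendsto_nhds_unique tendsto_const_nhds this]
    have := hz₀.1
    have := hz₀.2
    unfold mono
    positivity
  obtain ⟨T, hT, hT0, hTpos⟩ := exists_first_zero hψ.continuousOn hψnn hψ0 hψ1
  set γ₀ : ℝ → ℝ × ℝ := fun t => (f t / ψ t, g t / ψ t) with hγ₀
  have hIco : Ico 0 T ⊆ Ico (0:ℝ) 1 := Ico_subset_Ico_right hT.2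
  have hpt : ∀ t ∈ Ico 0 T, Tendsto (fun k => γ (ρ (σ k)) t) atTop (𝓝 (γ₀ t)) := by
    intro t ht
    obtain ⟨h1, h2, h3⟩ := hlim t (hIco ht)
    have hne := (hTpos t ht).ne'
    refine ((h2.div h1 hne).prodMk_nhds (h3.div h1 hne)).congr fun k => ?_
    have hpos := (hγ (ρ (σ k))).curve.pos t (hIco ht)
    have := hpos.1.ne'
    have := hpos.2.ne'
    ext
    · simp only [Pi.div_apply, mono, add_zero, pow_succ]
      field_simp
    · simp only [Pi.div_apply, mono, add_zero, pow_succ]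
      field_simp
  have hmono : ∀ t ∈ Ico 0 T, mono n 0 0 (γ₀ t) = ψ t := fun t ht =>
    tendsto_nhds_unique (((continuous_mono n 0 0).tendsto _).comp (hpt t ht)) (hlim t (hIco ht)).1
  have hnn : ∀ t ∈ Ico 0 T, 0 ≤ (γ₀ t).1 ∧ 0 ≤ (γ₀ t).2 := fun t ht =>
    ⟨ge_of_tendsto' ((continuous_fst.tendsto _).comp (hpt t ht)) fun k =>
      ((hγ _).curve.pos t (hIco ht)).1.le,
     ge_of_tendsto' ((continuous_snd.tendsto _).comp (hpt t ht)) fun k =>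
      ((hγ _).curve.pos t (hIco ht)).2.le⟩
  have hcurve : IsCurve T γ₀ := by
    refine ⟨fun t ht => ?_, fun a ha => ?_⟩
    · have h := hTpos t ht
      rw [← hmono t ht, mono, add_zero] at h
      have hn0 : n ≠ 0 := by omega
      refine ⟨lt_of_le_of_ne (hnn t ht).1 fun h0 => ?_, lt_of_le_of_ne (hnn t ht).2 fun h0 => ?_⟩
      · rw [← h0, zero_pow hn0, zero_mul] at h
        exact h.false
      · rw [← h0, zero_pow hn0, mul_zero] at h
        exact h.false
    · have hsub : Icc 0 a ⊆ Icc (0:ℝ) 1 := Icc_subset_Icc_right (ha.2.le.trans hT.2)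
      obtain ⟨s, hs, hmin⟩ := isCompact_Icc.exists_isMinOn ⟨0, ⟨le_rfl, ha.1⟩⟩
        (hψ.continuousOn.mono hsub)
      have hm := hTpos s ⟨hs.1, hs.2.trans_lt ha.2⟩
      obtain ⟨K₁, hK₁⟩ := (hf.mono hsub).exists_div (hψ.mono hsub) hm fun t ht => hmin ht
      obtain ⟨K₂, hK₂⟩ := (hg.mono hsub).exists_div (hψ.mono hsub) hm fun t ht => hmin ht
      exact ⟨_, hK₁.prodMk hK₂⟩
  have hdisc : ∀ t ∈ Ico 0 T, (γ₀ t).1 ^ 2 + (γ₀ t).2 ^ 2 ≤ R ^ 2 := by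
    intro t ht
    have hφ : Continuous fun z : ℝ × ℝ => z.1 ^ 2 + z.2 ^ 2 := by fun_prop
    exact le_of_tendsto' ((hφ.tendsto _).comp (hpt t ht)) fun k => (hγ _).disc t (hIco ht)
  have hbound : ∀ᵐ t, t ∈ Ioo 0 T → hspd n cn γ₀ t ≤ M := by
    filter_upwards [hcurve.ae_differentiableAt] with t hd ht
    exact hspd_le_of_tendsto hn hcn (fun k => hγ (ρ (σ k))) (hLM.comp hσ.tendsto_atTop)
      (fun k => hK (σ k)) hT.2 hcurve hpt ht (hd ht).1 (hd ht).2
  have hvanish : Tendsto (fun t => (γ₀ t).1 * (γ₀ t).2) (𝓝[<] T) (𝓝 0) := by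
    have hψT : Tendsto ψ (𝓝[<] T) (𝓝 0) := by
      have h1 := hψ.continuousOn T ⟨hT.1.le, hT.2⟩
      rw [ContinuousWithinAt, hT0] at h1
      refine h1.mono_left (nhdsWithin_le_of_mem ?_)
      filter_upwards [Ioo_mem_nhdsLT hT.1] with t ht
      exact ⟨ht.1.le, ht.2.le.trans hT.2⟩
    rw [Metric.tendsto_nhds]
    intro ε hε
    filter_upwards [Ioo_mem_nhdsLT hT.1, hψT.eventually (gt_mem_nhds (pow_pos hε n))] with t ht hlt
    have ht' : t ∈ Ico 0 T := ⟨ht.1.le, ht.2⟩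
    rw [← hmono t ht', mono, add_zero, ← mul_pow] at hlt
    rw [Real.dist_eq, sub_zero, abs_of_nonneg (mul_nonneg (hnn t ht').1 (hnn t ht').2)]
    exact lt_of_pow_lt_pow_left₀ n hε.le hlt
  have hb₀ : IsBdryCurve n cn T M γ₀ := ⟨hcurve, hbound, hvanish⟩
  have hinit : γ₀ 0 = z₀ := by
    have := hpt 0 ⟨le_rfl, hT.1⟩
    simp only [(hγ _).init] at this
    exact tendsto_nhds_unique this tendsto_const_nhds
  obtain ⟨L', τ, η, r, hη, hηlim⟩ := hb₀.exists_isReparam hcn hT.1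
  obtain ⟨B, -, hB⟩ := exists_Fvol_le n hcn hR
  have hw : WeightedBound n cn p η Λ L' :=
    r.weightedBound_of_le hcn hp hΛ hM0 hT.2 hcurve hbound hη
      (fun t ht => hB _ (hη.pos t ht) (r.disc hdisc t ht)) fun v hv hv0 hvT =>
      hv.elim fun K' hK' => integral_le_of_tendsto hcn (by linarith) hR
        (fun k => hγ (ρ (σ k))) (hLM.comp hσ.tendsto_atTop)
        (hc.comp (hρ.comp hσ).tendsto_atTop) hM0 hT.2 hpt hK' hv0 hvT
  exact ⟨L', η, hinit ▸ r.isNormalized hcn hT.1 hcurve hdisc hη hηlim hw⟩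

end

/-- The vertical segment from the starting point to the boundary. -/
theorem exists_memRh_disc (n : ℕ) {cn x0 y0 : ℝ} (hcn : 0 < cn) (hx0 : 0 < x0) (hy0 : 0 < y0) :
    ∃ γ, MemRh n cn x0 y0 γ ∧ ∀ t ∈ Ico (0:ℝ) 1, (γ t).1 ^ 2 + (γ t).2 ^ 2 ≤ x0 ^ 2 + y0 ^ 2 := by
  set γ : ℝ → ℝ × ℝ := fun t => (x0, y0 * (1 - t)) with hγ
  have hpos : ∀ t ∈ Ico (0:ℝ) 1, γ t ∈ Pint := fun t ht =>
    ⟨hx0, mul_pos hy0 (by linarith [ht.2])⟩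
  have hdisc : ∀ t ∈ Ico (0:ℝ) 1, (γ t).1 ^ 2 + (γ t).2 ^ 2 ≤ x0 ^ 2 + y0 ^ 2 := by
    intro t ht
    have h1 : (1 - t) ^ 2 ≤ 1 := by nlinarith [ht.1, ht.2]
    have : (y0 * (1 - t)) ^ 2 ≤ y0 ^ 2 := by
      rw [mul_pow]
      exact mul_le_of_le_one_right (by positivity) h1
    simpa [hγ] using this
  obtain ⟨B, -, hB⟩ := exists_Fvol_le n hcn (Real.sqrt_nonneg (x0 ^ 2 + y0 ^ 2))
  have hR : Real.sqrt (x0 ^ 2 + y0 ^ 2) ^ 2 = x0 ^ 2 + y0 ^ 2 := Real.sq_sqrt (by positivity)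
  have hspeed : ∀ t, spd γ t = y0 := by
    intro t
    have h2 : deriv (fun u : ℝ => y0 * (1 - u)) t = -y0 := by
      simp
    simp [spd, hγ, h2, Real.sqrt_sq hy0.le]
  refine ⟨γ, memRh_iff.2 ⟨by simp [hγ], B * y0, ⟨hpos, fun a _ => ?_⟩, ?_, ?_⟩, hdisc⟩
  · refine ⟨_, ((LipschitzWith.const x0).prodMk
      ((lipschitzWith_smul y0).comp ((LipschitzWith.const (1:ℝ)).sub LipschitzWith.id))
      ).lipschitzOnWith⟩
  · refine Eventually.of_forall fun t ht => ?_
    have ht' : t ∈ Ico (0:ℝ) 1 := ⟨ht.1.le, ht.2⟩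
    rw [hspd, hspeed t]
    exact mul_le_mul_of_nonneg_right (hB _ (hpos t ht') ((hdisc t ht').trans hR.ge)) hy0.le
  · have hc : Continuous fun t => (γ t).1 * (γ t).2 := by fun_prop
    have := (hc.tendsto 1).mono_left (nhdsWithin_le_nhds (s := Iio 1))
    simpa [hγ] using this

/-- Every curve in `R_h` can be replaced by a normalized curve in the disc without decreasing
its eigenvalue. -/
theorem exists_isNormalized_lambdaH {n : ℕ} {cn p x0 y0 R : ℝ} (hn : 2 ≤ n) (hcn : 0 < cn)
    (hp : 2 * (n : ℝ) - 1 ≤ p) (hR : 0 < R) (hz₀ : x0 ^ 2 + y0 ^ 2 ≤ R ^ 2) {γ : ℝ → ℝ × ℝ}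
    (hγ : MemRh n cn x0 y0 γ) :
    ∃ L η, IsNormalized n cn p R (x0, y0) (lambdaH n cn p γ) L η := by
  have hn' : (2:ℝ) ≤ n := by exact_mod_cast hn
  have hp1 : 1 < p := by linarith
  obtain ⟨hinit, M, hM⟩ := memRh_iff.1 hγ
  have hfold := isBdryCurve_fold hcn hR one_pos hM
  have hray := rayleighBound_fold hn hcn hR hp (lambdaH_nonneg hcn hγ) hM
    (rayleighBound_lambdaH hcn hp1 hγ)
  obtain ⟨L, τ, η, r, hη, hηlim⟩ := hfold.exists_isReparam hcn one_pos
  obtain ⟨B, -, hB⟩ := exists_Fvol_le n hcn hR.le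
  have hdisc : ∀ t ∈ Ico (0:ℝ) 1, (fold R (γ t)).1 ^ 2 + (fold R (γ t)).2 ^ 2 ≤ R ^ 2 :=
    fun t _ => fold_norm_le hR _
  have hw := r.weightedBound hcn hp1 hfold.toIsCurve hη
    (fun t ht => hB _ (hη.pos t ht) (r.disc hdisc t ht)) hray
  have h := r.isNormalized hcn one_pos hfold.toIsCurve hdisc hη hηlim hw
  have h0 : fold R (γ 0) = (x0, y0) := by
    rw [hinit, fold, foldFactor_of_le hR hz₀, one_mul, one_mul]
  exact ⟨L, η, h0 ▸ h⟩

/-- For `p ≥ 2n-1` there is a curve `α ∈ R_h` attaining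
`Λ_p = sup{λ_{1,p}(γ) : γ ∈ R_h}` whose image stays in the disc
`{(x,y) ∈ P : x² + y² ≤ x₀² + y₀²}`. -/
theorem simons_stmt7 (n : ℕ) (hn : 2 ≤ n) (cn : ℝ) (hcn : 0 < cn)
    (x0 y0 : ℝ) (hy0 : 0 < y0) (hxy : y0 ≤ x0)
    (p : ℝ) (hp : 2 * (n : ℝ) - 1 ≤ p) :
    ∃ α : ℝ → ℝ × ℝ, MemRh n cn x0 y0 α ∧
      (∀ γ : ℝ → ℝ × ℝ, MemRh n cn x0 y0 γ → lambdaH n cn p γ ≤ lambdaH n cn p α) ∧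
      ∀ t ∈ Ico (0:ℝ) 1, (α t).1 ^ 2 + (α t).2 ^ 2 ≤ x0 ^ 2 + y0 ^ 2 := by
  have hn' : (2:ℝ) ≤ n := by exact_mod_cast hn
  have hp1 : 1 < p := by linarith
  have hx0 : 0 < x0 := hy0.trans_le hxy
  set R := Real.sqrt (x0 ^ 2 + y0 ^ 2) with hRdef
  have hR : 0 < R := Real.sqrt_pos.2 (by positivity)
  have hR2 : R ^ 2 = x0 ^ 2 + y0 ^ 2 := Real.sq_sqrt (by positivity)
  have hz₀ : (x0, y0) ∈ Pint := ⟨hx0, hy0⟩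
  have hnorm : ∀ γ, MemRh n cn x0 y0 γ →
      ∃ L η, IsNormalized n cn p R (x0, y0) (lambdaH n cn p γ) L η := fun γ hγ =>
    exists_isNormalized_lambdaH hn hcn hp hR hR2.ge hγ
  by_cases htriv : ∀ γ, MemRh n cn x0 y0 γ → lambdaH n cn p γ ≤ 0
  · obtain ⟨α, hα, hdisc⟩ := exists_memRh_disc n hcn hx0 hy0
    exact ⟨α, hα, fun γ hγ => (htriv γ hγ).trans (lambdaH_nonneg hcn hα), hdisc⟩
  push Not at htriv
  obtain ⟨γ₁, hγ₁, hpos⟩ := htriv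
  set S := {q | ∃ γ, MemRh n cn x0 y0 γ ∧ lambdaH n cn p γ = q} with hS
  obtain ⟨C, hC⟩ := exists_bound_le (n := n) (by omega) hcn (zero_lt_one.trans hp1) hR.le hz₀
  have hbdd : BddAbove S := by
    refine ⟨C, ?_⟩
    rintro _ ⟨γ, hγ, rfl⟩
    obtain ⟨L, η, h⟩ := hnorm γ hγ
    exact hC _ L η h
  have hΛ : 0 < sSup S := hpos.trans_le (le_csSup hbdd ⟨γ₁, hγ₁, rfl⟩)
  obtain ⟨u, -, hu, huS⟩ := exists_seq_tendsto_sSup (S := S) ⟨_, γ₁, hγ₁, rfl⟩ hbdd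
  obtain ⟨N, hN⟩ := eventually_atTop.1 (hu.eventually (lt_mem_nhds (half_lt_self hΛ)))
  have hex : ∀ k, ∃ L η, IsNormalized n cn p R (x0, y0) (u (k + N)) L η := by
    intro k
    obtain ⟨γ, hγ, hq⟩ := huS (k + N)
    exact hq ▸ hnorm γ hγ
  choose L η hη using hex
  obtain ⟨l, hl⟩ := exists_length_le (n := n) (z₀ := (x0, y0)) hcn (zero_lt_one.trans hp1) hR.le
    (half_pos hΛ)
  obtain ⟨L', α, hα⟩ := exists_isNormalized_of_tendsto (by omega) hcn hR.le hp1 hz₀ hη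
    (fun k => hl _ _ _ (hN (k + N) (Nat.le_add_left N k)).le (hη k)) hΛ.le
    (hu.comp (tendsto_add_atTop_nat N))
  have hmem : MemRh n cn x0 y0 α := memRh_iff.2 ⟨hα.init, L', hα.curve⟩
  obtain ⟨B, -, hB⟩ := exists_Fvol_le n hcn hR.le
  have hmax := le_lambdaH hcn hp1 hα.L_pos hmem hα.speed
    ⟨B, fun t ht => hB _ (hα.curve.pos t ⟨ht.1.le, ht.2⟩) (hα.disc t ⟨ht.1.le, ht.2⟩)⟩ hα.weighted
  exact ⟨α, hmem, fun γ hγ => (le_csSup hbdd ⟨γ, hγ, rfl⟩).trans hmax,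
    fun t ht => (hα.disc t ht).trans hR2.le⟩
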